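/- Let A be a nonempty countable set of players, C a nonempty set of choices, d : C* → A, and for each a ∈ A let f_a : C^ω → [0,1] be Borel measurable, where C^ω carries the product topology induced by the discrete topology on C and the corresponding Borel σ-algebra. Then for every ε > 0 the infinite sequential game ⟨A, C, d, (f_a)_{a∈A}⟩ has an ε-Nash equilibrium. -/

import Mathlib

namespace SeqGame

variable {A C O : Type*}

/-- The length-`n` prefix of an infinite sequence, as a list. -/
def pre (p : ℕ → C) (n : ℕ) : List C := List.ofFn (fun i : Fin n => p i)

/-- The length-`n` history of the play induced by the strategy profile `σ` starting at `γ`. -/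
def hist (σ : List C → C) (γ : List C) : ℕ → List C
  | 0 => []
  | n + 1 => hist σ γ n ++
      [if h : n < γ.length then γ.get ⟨n, h⟩ else σ (hist σ γ n)]

/-- The play `p^γ(σ)` induced by the strategy profile `σ` starting at `γ`. -/
def play (σ : List C → C) (γ : List C) (n : ℕ) : C :=
  if h : n < γ.length then γ.get ⟨n, h⟩ else σ (hist σ γ n)

/-- `σ'` is an `a`-deviation of the strategy profile `σ`. -/
def Dev (d : List C → A) (a : A) (σ σ' : List C → C) : Prop :=
  ∀ h : List C, d h ≠ a → σ' h = σ h

end SeqGame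
universe u v

/-- A board for games played through a decreasing sequence of equivalence relations on a set of
plays: `E n x y` says that `x` and `y` agree up to level `n`, and `F n x y` says that a player who
follows a quasistrategy may move from the level-`n` position of `x` towards `y`. -/
structure Board (Y : Type v) where
  E : ℕ → Y → Y → Prop
  F : ℕ → Y → Y → Prop
  equiv : ∀ n, Equivalence (E n)
  mono : ∀ n x y, E (n + 1) x y → E n x y
  sub : ∀ n x y, F n x y → E n x y

namespace Board

variable {Y : Type v} (B : Board Y)

theorem refl (n : ℕ) (x : Y) : B.E n x x := (B.equiv n).refl x

variable {B}

theorem symm {n : ℕ} {x y : Y} (h : B.E n x y) : B.E n y x := (B.equiv n).symm h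

theorem trans {n : ℕ} {x y z : Y} (h : B.E n x y) (h' : B.E n y z) : B.E n x z :=
  (B.equiv n).trans h h'

theorem anti {m n : ℕ} (hmn : m ≤ n) {x y : Y} (h : B.E n x y) : B.E m x y := by
  induction n, hmn using Nat.le_induction with
  | base => exact h
  | succ n _ ih => exact ih (B.mono _ _ _ h)

variable (B)

/-- `R` is a quasistrategy, from level `s` on, for the player who moves at the levels of
parity `b`. -/
structure IsQS (b : Bool) (s : ℕ) (R : ℕ → Y → Prop) : Prop where
  resp : ∀ n, s ≤ n → ∀ x y, B.E n x y → R n x → R n y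
  own : ∀ n, s ≤ n → n.bodd = b → ∀ x, R n x → ∃ y, B.F n x y ∧ R (n + 1) y
  opp : ∀ n, s ≤ n → n.bodd ≠ b → ∀ x, R n x → R (n + 1) x

/-- `R` is a quasistrategy from the level-`s` position of `y` that wins `T`. -/
def Good (b : Bool) (T : Set Y) (s : ℕ) (y : Y) (R : ℕ → Y → Prop) : Prop :=
  B.IsQS b s R ∧ R s y ∧ ∀ z, (∀ n, s ≤ n → R n z) → z ∈ T

/-- Player `b` can force `T` from the level-`s` position of `y`. -/
def Win (b : Bool) (T : Set Y) (s : ℕ) (y : Y) : Prop := ∃ R, B.Good b T s y R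

variable {B} {b : Bool} {T : Set Y}

theorem good_congr {s : ℕ} {x y : Y} (h : B.E s x y) : B.Good b T s x = B.Good b T s y := by
  funext R
  refine propext ⟨fun ⟨h1, h2, h3⟩ => ⟨h1, h1.resp s le_rfl _ _ h h2, h3⟩,
    fun ⟨h1, h2, h3⟩ => ⟨h1, h1.resp s le_rfl _ _ (symm h) h2, h3⟩⟩

theorem Win.resp {s : ℕ} {x y : Y} (h : B.E s x y) (hw : B.Win b T s x) : B.Win b T s y := by
  unfold Win
  rw [← good_congr h]
  exact hw

/-- A position predicate that can be maintained until a winning position is reached can be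
completed to a quasistrategy. -/
theorem glue (s : ℕ) (G : ℕ → Y → Prop)
    (hresp : ∀ n, s ≤ n → ∀ x y, B.E n x y → G n x → G n y)
    (hown : ∀ n, s ≤ n → n.bodd = b → ∀ x, G n x →
      ∃ y, B.F n x y ∧ (G (n + 1) y ∨ B.Win b T (n + 1) y))
    (hopp : ∀ n, s ≤ n → n.bodd ≠ b → ∀ x, G n x → G (n + 1) x ∨ B.Win b T (n + 1) x)
    (hlim : ∀ x, (∀ n, s ≤ n → G n x) → x ∈ T ∨ ∃ n, s ≤ n ∧ B.Win b T n x) :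
    ∃ R, B.IsQS b s R ∧ (∀ x, R s x ↔ (G s x ∨ B.Win b T s x)) ∧
      ∀ x, (∀ n, s ≤ n → R n x) → x ∈ T := by
  classical
  set Rc : ℕ → Y → ℕ → Y → Prop := fun i y => Classical.epsilon (B.Good b T i y) with hRc
  have hgood : ∀ i y, B.Win b T i y → B.Good b T i y (Rc i y) := fun i y h =>
    Classical.epsilon_spec h
  have hcongr : ∀ i x y, B.E i x y → Rc i x = Rc i y := fun i x y h => by
    simp only [hRc, good_congr h]
  set P : ℕ → Y → Prop := fun n x => ∀ i, s ≤ i → i ≤ n → G i x ∧ ¬ B.Win b T i x with hP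
  set Q : ℕ → ℕ → Y → Prop := fun i n x => s ≤ i ∧ i ≤ n ∧ B.Win b T i x ∧
    (∀ j, s ≤ j → j < i → ¬ B.Win b T j x) ∧ Rc i x n x with hQ
  have hPr : ∀ n x y, B.E n x y → P n x → P n y := by
    intro n x y h hx i h1 h2
    have hE := anti h2 h
    exact ⟨hresp i h1 _ _ hE (hx i h1 h2).1, fun hw => (hx i h1 h2).2 (hw.resp (symm hE))⟩
  have hQr : ∀ i n x y, B.E n x y → Q i n x → ∀ m, n ≤ m → (Rc i x m y) → Q i m y := by
    rintro i n x y h ⟨h1, h2, h3, h4, h5⟩ m hm hR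
    have hE := anti h2 h
    refine ⟨h1, h2.trans hm, h3.resp hE, fun j hj hj' hw => h4 j hj hj' (hw.resp ?_), ?_⟩
    · exact symm (anti (hj'.le.trans h2) h)
    · rw [← hcongr i x y hE]; exact hR
  have hnext : ∀ n, s ≤ n → ∀ x y, P n x → B.E n x y → (G (n + 1) y ∨ B.Win b T (n + 1) y) →
      P (n + 1) y ∨ ∃ i, Q i (n + 1) y := by
    intro n hn x y hx hE h
    have hy := hPr n x y hE hx
    by_cases hw : B.Win b T (n + 1) y
    · refine Or.inr ⟨n + 1, by omega, le_rfl, hw, fun j hj hj' => (hy j hj (by omega)).2, ?_⟩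
      exact (hgood _ _ hw).2.1
    · refine Or.inl fun i h1 h2 => ?_
      rcases Nat.lt_or_ge i (n + 1) with h3 | h3
      · exact hy i h1 (by omega)
      · obtain rfl : i = n + 1 := by omega
        exact ⟨h.resolve_right hw, hw⟩
  refine ⟨fun n x => P n x ∨ ∃ i, Q i n x, ⟨?_, ?_, ?_⟩, ?_, ?_⟩
  · rintro n hn x y h (hx | ⟨i, hi⟩)
    · exact Or.inl (hPr n x y h hx)
    · refine Or.inr ⟨i, hQr i n x y h hi n le_rfl ?_⟩
      exact (hgood i x hi.2.2.1).1.resp n hi.2.1 x y h hi.2.2.2.2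
  · rintro n hn hb x (hx | ⟨i, hi⟩)
    · obtain ⟨y, hy, hy'⟩ := hown n hn hb x (hx n hn le_rfl).1
      exact ⟨y, hy, hnext n hn x y hx (B.sub _ _ _ hy) hy'⟩
    · obtain ⟨y, hy, hy'⟩ := (hgood i x hi.2.2.1).1.own n hi.2.1 hb x hi.2.2.2.2
      exact ⟨y, hy, Or.inr ⟨i, hQr i n x y (B.sub _ _ _ hy) hi _ (Nat.le_succ n) hy'⟩⟩
  · rintro n hn hb x (hx | ⟨i, hi⟩)
    · exact hnext n hn x x hx (B.refl n x) (hopp n hn hb x (hx n hn le_rfl).1)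
    · exact Or.inr ⟨i, hQr i n x x (B.refl n x) hi _ (Nat.le_succ n)
        ((hgood i x hi.2.2.1).1.opp n hi.2.1 hb x hi.2.2.2.2)⟩
  · intro x
    constructor
    · rintro (hx | ⟨i, h1, h2, h3, -, -⟩)
      · exact Or.inl (hx s le_rfl le_rfl).1
      · obtain rfl : i = s := by omega
        exact Or.inr h3
    · intro h
      by_cases hw : B.Win b T s x
      · exact Or.inr ⟨s, le_rfl, le_rfl, hw, fun j _ _ => by omega, (hgood _ _ hw).2.1⟩
      · refine Or.inl fun i h1 h2 => ?_
        obtain rfl : i = s := by omega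
        exact ⟨h.resolve_right hw, hw⟩
  · intro x hx
    by_cases hw : ∃ n, s ≤ n ∧ B.Win b T n x
    · obtain ⟨h1, h2⟩ := Nat.find_spec hw
      have hmin : ∀ j, s ≤ j → j < Nat.find hw → ¬ B.Win b T j x := fun j hj hj' h =>
        Nat.find_min hw hj' ⟨hj, h⟩
      refine (hgood _ _ h2).2.2 x fun n hn => ?_
      rcases hx n (h1.trans hn) with hP' | ⟨i, i1, i2, i3, i4, i5⟩
      · exact absurd h2 (hP' _ h1 hn).2
      · have : i = Nat.find hw := by
          rcases lt_trichotomy i (Nat.find hw) with h | h | h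
          · exact absurd i3 (hmin i i1 h)
          · exact h
          · exact absurd h2 (i4 _ h1 h)
        rw [this] at i5
        exact i5
    · push Not at hw
      refine (hlim x fun n hn => ?_).resolve_right fun ⟨n, hn, h⟩ => hw n hn h
      rcases hx n hn with hP' | ⟨i, i1, i2, i3, i4, i5⟩
      · exact (hP' n hn le_rfl).1
      · exact absurd i3 (hw i i1)

theorem Win.of_glue {s : ℕ} (G : ℕ → Y → Prop)
    (hresp : ∀ n, s ≤ n → ∀ x y, B.E n x y → G n x → G n y)
    (hown : ∀ n, s ≤ n → n.bodd = b → ∀ x, G n x →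
      ∃ y, B.F n x y ∧ (G (n + 1) y ∨ B.Win b T (n + 1) y))
    (hopp : ∀ n, s ≤ n → n.bodd ≠ b → ∀ x, G n x → G (n + 1) x ∨ B.Win b T (n + 1) x)
    (hlim : ∀ x, (∀ n, s ≤ n → G n x) → x ∈ T ∨ ∃ n, s ≤ n ∧ B.Win b T n x)
    {x : Y} (hx : G s x) : B.Win b T s x := by
  obtain ⟨R, h1, h2, h3⟩ := glue s G hresp hown hopp hlim
  exact ⟨R, h1, (h2 x).2 (Or.inl hx), h3⟩

theorem Win.of_own {n : ℕ} (hb : n.bodd = b) {x : Y} (y : Y) (hF : ∀ z, B.E n x z → B.F n z y)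
    (hw : B.Win b T (n + 1) y) : B.Win b T n x := by
  refine Win.of_glue (fun m z => m = n ∧ B.E n x z) ?_ ?_ ?_ ?_ ⟨rfl, B.refl n x⟩
  · rintro m - z w h ⟨rfl, h'⟩
    exact ⟨rfl, trans h' h⟩
  · rintro m - - z ⟨rfl, h'⟩
    exact ⟨y, hF z h', Or.inr hw⟩
  · rintro m - hm z ⟨rfl, h'⟩
    exact absurd hb hm
  · intro z hz
    have := (hz (n + 1) (Nat.le_succ n)).1
    omega

theorem Win.of_opp {n : ℕ} (hb : n.bodd ≠ b) {x : Y}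
    (hw : ∀ y, B.E n x y → B.Win b T (n + 1) y) : B.Win b T n x := by
  refine Win.of_glue (fun m z => m = n ∧ B.E n x z) ?_ ?_ ?_ ?_ ⟨rfl, B.refl n x⟩
  · rintro m - z w h ⟨rfl, h'⟩
    exact ⟨rfl, trans h' h⟩
  · rintro m - hm z ⟨rfl, h'⟩
    exact absurd hm hb
  · rintro m - hm z ⟨rfl, h'⟩
    exact Or.inr (hw z h')
  · intro z hz
    have := (hz (n + 1) (Nat.le_succ n)).1
    omega

theorem Win.own {n : ℕ} {x : Y} (hw : B.Win b T n x) (hb : n.bodd = b) :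
    ∃ y, B.F n x y ∧ B.Win b T (n + 1) y := by
  obtain ⟨R, hR, hRx, hRT⟩ := hw
  obtain ⟨y, hy, hy'⟩ := hR.own n le_rfl hb x hRx
  have hRy := hR.resp n le_rfl _ _ (B.sub _ _ _ hy) hRx
  refine ⟨y, hy, fun m z => R m z ∧ R n z, ⟨fun m hm w z h hw => ?_, fun m hm hb w hw => ?_,
    fun m hm hb w hw => ⟨hR.opp m (by omega) hb w hw.1, hw.2⟩⟩, ⟨hy', hRy⟩, fun z hz => ?_⟩
  · exact ⟨hR.resp m (by omega) _ _ h hw.1, hR.resp n le_rfl _ _ (anti (by omega) h) hw.2⟩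
  · obtain ⟨z, hz, hz'⟩ := hR.own m (by omega) hb w hw.1
    exact ⟨z, hz, hz', hR.resp n le_rfl _ _ (anti (by omega) (B.sub _ _ _ hz)) hw.2⟩
  · refine hRT z fun m hm => ?_
    rcases hm.eq_or_lt with rfl | h
    · exact (hz (n + 1) le_rfl).2
    · exact (hz m h).1

end Board

/-- A game arena: the plays of a game in which the two players move alternately, the one with
parity `false` at even levels; `E n` says that two plays agree up to level `n`. -/
structure Arena : Type (u + 1) where
  X : Type u
  E : ℕ → X → X → Prop
  equiv : ∀ n, Equivalence (E n)
  mono : ∀ n x y, E (n + 1) x y → E n x y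
  zero : ∀ x y, E 0 x y
  sep : ∀ x y, (∀ n, E n x y) → x = y
  complete : ∀ x : ℕ → X, (∀ n, E n (x n) (x (n + 1))) → ∃ y, ∀ n, E n y (x n)

namespace Arena

instance : CoeSort Arena.{u} (Type u) := ⟨Arena.X⟩

variable (𝒳 : Arena.{u})

/-- The board of an arena, on which every legal move is allowed. -/
abbrev board : Board 𝒳 where
  E := 𝒳.E
  F := 𝒳.E
  equiv := 𝒳.equiv
  mono := 𝒳.mono
  sub := fun _ _ _ h => h

theorem refl (n : ℕ) (x : 𝒳) : 𝒳.E n x x := (𝒳.equiv n).refl x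

variable {𝒳}

theorem symm {n : ℕ} {x y : 𝒳} (h : 𝒳.E n x y) : 𝒳.E n y x := (𝒳.equiv n).symm h

theorem trans {n : ℕ} {x y z : 𝒳} (h : 𝒳.E n x y) (h' : 𝒳.E n y z) : 𝒳.E n x z :=
  (𝒳.equiv n).trans h h'

theorem anti {m n : ℕ} (hmn : m ≤ n) {x y : 𝒳} (h : 𝒳.E n x y) : 𝒳.E m x y :=
  Board.anti (B := 𝒳.board) hmn h

theorem exists_play {s : ℕ} {P : ℕ → 𝒳 → Prop}
    (hresp : ∀ n, s ≤ n → ∀ x y, 𝒳.E n x y → P n x → P n y)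
    (hstep : ∀ n, s ≤ n → ∀ x, P n x → ∃ y, 𝒳.E n x y ∧ P (n + 1) y) {x : 𝒳} (hx : P s x) :
    ∃ y, 𝒳.E s x y ∧ ∀ n, s ≤ n → P n y := by
  classical
  choose! g hg hg' using hstep
  let q : ℕ → 𝒳 := fun k => Nat.rec x (fun k y => g (s + k) y) k
  have hq : ∀ k, P (s + k) (q k) := by
    intro k
    induction k with
    | zero => exact hx
    | succ k ih => exact hg' (s + k) (by omega) _ ih
  have hqE : ∀ k, 𝒳.E (s + k) (q k) (q (k + 1)) := fun k => hg (s + k) (by omega) _ (hq k)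
  obtain ⟨y, hy⟩ := 𝒳.complete (fun n => q (n - s)) (by
    intro n
    rcases Nat.lt_or_ge n s with h | h
    · have h1 : n - s = 0 := by omega
      have h2 : n + 1 - s = 0 := by omega
      simp only [h1, h2]
      exact 𝒳.refl _ _
    · obtain ⟨k, rfl⟩ := Nat.exists_eq_add_of_le h
      have h1 : s + k - s = k := by omega
      have h2 : s + k + 1 - s = k + 1 := by omega
      simp only [h1, h2]
      exact hqE k)
  have hy' : ∀ k, 𝒳.E (s + k) y (q k) := fun k => by
    have := hy (s + k)
    simpa using this
  refine ⟨y, symm (hy' 0), fun n hn => ?_⟩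
  obtain ⟨k, rfl⟩ := Nat.exists_eq_add_of_le hn
  exact hresp _ hn _ _ (symm (hy' k)) (hq k)

variable (𝒳)

/-- `S` contains every play all of whose positions are positions of `S`. -/
def ClosedSet (S : Set 𝒳) : Prop := ∀ x, (∀ n, ∃ z ∈ S, 𝒳.E n x z) → x ∈ S

/-- From level `s` on, the moves of the opponent of `b` that stay in `D` cannot leave `S`. -/
def ClosedFrom (b : Bool) (s : ℕ) (S D : Set 𝒳) : Prop :=
  ∀ n, s ≤ n → n.bodd ≠ b → ∀ z ∈ S, ∀ y ∈ D, 𝒳.E n z y → ∃ w ∈ S, 𝒳.E (n + 1) y w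

/-- The plays of `S` through the level-`s` position of `w` along which `b` never gets to a position
from which `T` can be forced. -/
def avoid (b : Bool) (T S : Set 𝒳) (s : ℕ) (w : 𝒳) : Set 𝒳 :=
  {y | y ∈ S ∧ 𝒳.E s w y ∧ ∀ m, s ≤ m → ¬ 𝒳.board.Win b T m y}

variable {𝒳} {b : Bool} {T S : Set 𝒳} {s : ℕ}

theorem ClosedSet.inter_class (hS : 𝒳.ClosedSet S) (j : ℕ) (x : 𝒳) :
    𝒳.ClosedSet {y | y ∈ S ∧ 𝒳.E j x y} := by
  intro y hy
  refine ⟨hS y fun n => ?_, ?_⟩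
  · obtain ⟨z, hz, h⟩ := hy n
    exact ⟨z, hz.1, h⟩
  · obtain ⟨z, hz, h⟩ := hy j
    exact trans hz.2 (symm h)

theorem win_of_subset (hS : 𝒳.ClosedSet S) (hSb : 𝒳.ClosedFrom b s S Set.univ) {y : 𝒳}
    (hy : y ∈ S) (hT : ∀ z ∈ S, 𝒳.E s y z → z ∈ T) : 𝒳.board.Win b T s y := by
  refine ⟨fun n x => ∃ w ∈ S, 𝒳.E n x w ∧ 𝒳.E s y x, ⟨?_, ?_, ?_⟩,
    ⟨y, hy, 𝒳.refl _ _, 𝒳.refl _ _⟩, ?_⟩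
  · rintro n hn x z h ⟨w, hw, h1, h2⟩
    exact ⟨w, hw, trans (symm h) h1, trans h2 (anti hn h)⟩
  · rintro n hn - x ⟨w, hw, h1, h2⟩
    exact ⟨w, h1, w, hw, 𝒳.refl _ _, trans h2 (anti hn h1)⟩
  · rintro n hn hb x ⟨w, hw, h1, h2⟩
    obtain ⟨v, hv, h3⟩ := hSb n hn hb w hw x trivial (symm h1)
    exact ⟨v, hv, h3, h2⟩
  · intro z hz
    refine hT z (hS z fun n => ?_) (hz s le_rfl).choose_spec.2.2
    obtain ⟨w, hw, h1, h2⟩ := hz (max n s) (le_max_right _ _)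
    exact ⟨w, hw, anti (le_max_left _ _) h1⟩

theorem exists_avoid (hS : 𝒳.ClosedSet S) (hSb : 𝒳.ClosedFrom b s S Set.univ) {y : 𝒳}
    (hyS : ∃ z ∈ S, 𝒳.E s y z) (hy : ¬ 𝒳.board.Win b T s y) :
    ∃ u ∈ S, 𝒳.E s y u ∧ ∀ m, s ≤ m → ¬ 𝒳.board.Win b T m u := by
  set P : ℕ → 𝒳 → Prop := fun n y => (∃ z ∈ S, 𝒳.E n y z) ∧ ¬ 𝒳.board.Win b T n y
  have hresp : ∀ n, s ≤ n → ∀ x y, 𝒳.E n x y → P n x → P n y := by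
    rintro n - x z h ⟨⟨w, hw, h1⟩, h2⟩
    exact ⟨⟨w, hw, trans (symm h) h1⟩, fun h3 => h2 (h3.resp (B := 𝒳.board) (symm h))⟩
  have hstep : ∀ n, s ≤ n → ∀ x, P n x → ∃ y, 𝒳.E n x y ∧ P (n + 1) y := by
    rintro n hn x ⟨⟨w, hw, h1⟩, h2⟩
    by_cases hb : n.bodd = b
    · exact ⟨w, h1, ⟨w, hw, 𝒳.refl _ _⟩, fun h3 => h2
        (Board.Win.of_own (B := 𝒳.board) hb w (fun z hz => trans (symm hz) h1) h3)⟩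
    · by_contra! hcon
      refine h2 (Board.Win.of_opp (B := 𝒳.board) hb fun v hv => ?_)
      by_contra hv'
      obtain ⟨v', hv'S, h3⟩ := hSb n hn hb w hw v trivial (trans (symm h1) hv)
      exact hcon v hv ⟨⟨v', hv'S, h3⟩, hv'⟩
  obtain ⟨u, hu, hu'⟩ := exists_play hresp hstep (show P s y from ⟨hyS, hy⟩)
  refine ⟨u, hS u fun n => ?_, hu, fun m hm => (hu' m hm).2⟩
  obtain ⟨⟨w, hw, h1⟩, -⟩ := hu' (max n s) (le_max_right _ _)
  exact ⟨w, hw, anti (le_max_left _ _) h1⟩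

theorem ClosedSet.avoid (hS : 𝒳.ClosedSet S) (w : 𝒳) : 𝒳.ClosedSet (𝒳.avoid b T S s w) := by
  intro y hy
  refine ⟨hS y fun n => ?_, ?_, fun m hm h => ?_⟩
  · obtain ⟨z, hz, h⟩ := hy n
    exact ⟨z, hz.1, h⟩
  · obtain ⟨z, hz, h⟩ := hy s
    exact trans hz.2.1 (symm h)
  · obtain ⟨z, hz, h'⟩ := hy m
    exact hz.2.2 m hm (h.resp (B := 𝒳.board) h')

theorem exists_avoid_succ (hS : 𝒳.ClosedSet S) (hSb : 𝒳.ClosedFrom b s S Set.univ) {n : ℕ}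
    (hn : s ≤ n) {w z y : 𝒳} (hz : z ∈ 𝒳.avoid b T S s w) (hzy : 𝒳.E n z y)
    (hyS : ∃ v ∈ S, 𝒳.E (n + 1) y v) (hy : ¬ 𝒳.board.Win b T (n + 1) y) :
    ∃ u ∈ 𝒳.avoid b T S s w, 𝒳.E (n + 1) y u := by
  obtain ⟨u, hu, h1, h2⟩ := exists_avoid hS (fun m hm => hSb m (by omega)) hyS hy
  refine ⟨u, ⟨hu, trans hz.2.1 (anti hn (trans hzy (𝒳.mono _ _ _ h1))), fun m hm h => ?_⟩, h1⟩
  rcases Nat.lt_or_ge n m with h3 | h3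
  · exact h2 m h3 h
  · exact hz.2.2 m hm (h.resp (B := 𝒳.board)
      (symm (anti h3 (trans hzy (𝒳.mono _ _ _ h1)))))

theorem closedFrom_avoid (hS : 𝒳.ClosedSet S) (hSb : 𝒳.ClosedFrom b s S Set.univ) (w : 𝒳) :
    𝒳.ClosedFrom (!b) s (𝒳.avoid b T S s w) S := by
  intro n hn hb z hz y hy hzy
  refine exists_avoid_succ hS hSb hn hz hzy ⟨y, hy, 𝒳.refl _ _⟩ fun h => hz.2.2 n hn ?_
  have hb' : n.bodd = b := by
    revert hb; cases n.bodd <;> cases b <;> simp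
  exact Board.Win.of_own (B := 𝒳.board) hb' y (fun v hv => trans (symm hv) hzy) h

end Arena

/-- A quasistrategy of player `b` for the whole game. -/
@[ext]
structure Strat (𝒳 : Arena.{u}) (b : Bool) where
  R : ℕ → 𝒳 → Prop
  start : ∀ x, R 0 x
  mono : ∀ n x, R (n + 1) x → R n x
  resp : ∀ n x y, 𝒳.E n x y → R n x → R n y
  own : ∀ n, n.bodd = b → ∀ x, R n x → ∃ y, 𝒳.E n x y ∧ R (n + 1) y
  opp : ∀ n, n.bodd ≠ b → ∀ x, R n x → R (n + 1) x

namespace Strat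

variable {𝒳 : Arena.{u}} {b : Bool} (θ : Strat 𝒳 b)

theorem anti {m n : ℕ} (h : m ≤ n) {x : 𝒳} (hx : θ.R n x) : θ.R m x := by
  induction n, h using Nat.le_induction with
  | base => exact hx
  | succ n _ ih => exact ih (θ.mono _ _ hx)

theorem extend {m n : ℕ} (h : m ≤ n) {x : 𝒳} (hx : θ.R m x) : ∃ y, 𝒳.E m x y ∧ θ.R n y := by
  induction n, h using Nat.le_induction with
  | base => exact ⟨x, 𝒳.refl _ _, hx⟩
  | succ n hn ih =>
    obtain ⟨y, h1, h2⟩ := ih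
    by_cases hb : n.bodd = b
    · obtain ⟨z, h3, h4⟩ := θ.own n hb y h2
      exact ⟨z, Arena.trans h1 (Arena.anti hn h3), h4⟩
    · exact ⟨y, h1, θ.opp n hb y h2⟩

/-- Two quasistrategies agree up to level `n`. -/
def Agree (n : ℕ) (θ θ' : Strat 𝒳 b) : Prop := ∀ m ≤ n, θ.R m = θ'.R m

variable {θ}

theorem Agree.refl (n : ℕ) (θ : Strat 𝒳 b) : Agree n θ θ := fun _ _ => rfl

theorem Agree.symm {n : ℕ} {θ θ' : Strat 𝒳 b} (h : Agree n θ θ') : Agree n θ' θ :=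
  fun m hm => (h m hm).symm

theorem Agree.trans {n : ℕ} {θ θ' θ'' : Strat 𝒳 b} (h : Agree n θ θ') (h' : Agree n θ' θ'') :
    Agree n θ θ'' := fun m hm => (h m hm).trans (h' m hm)

theorem Agree.anti {m n : ℕ} (hmn : m ≤ n) {θ θ' : Strat 𝒳 b} (h : Agree n θ θ') :
    Agree m θ θ' := fun i hi => h i (hi.trans hmn)

end Strat

/-- A covering of the arena `𝒳` by the arena `𝒴` that is the identity up to level `K`. -/
structure Cover (K : ℕ) (𝒴 𝒳 : Arena.{u}) where
  π : 𝒴 → 𝒳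
  nonexp : ∀ n x y, 𝒴.E n x y → 𝒳.E n (π x) (π y)
  inj : ∀ n ≤ K, ∀ x y, 𝒳.E n (π x) (π y) → 𝒴.E n x y
  surj : ∀ x, ∃ y, π y = x
  φ : ∀ b, Strat 𝒴 b → Strat 𝒳 b
  loc : ∀ b n θ θ', Strat.Agree n θ θ' → Strat.Agree n (φ b θ) (φ b θ')
  low : ∀ b θ, ∀ n ≤ K, ∀ x, (φ b θ).R n x ↔ ∃ y, θ.R n y ∧ 𝒳.E n (π y) x
  lift : ∀ b θ x, (∀ n, (φ b θ).R n x) → ∃ y, (∀ n, θ.R n y) ∧ π y = x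

namespace Cover

/-- A covering that is the identity up to level `K` is so up to every smaller level. -/
def ofLE {J K : ℕ} (h : J ≤ K) {𝒴 𝒳 : Arena.{u}} (c : Cover K 𝒴 𝒳) : Cover J 𝒴 𝒳 where
  __ := c
  inj := fun n hn => c.inj n (hn.trans h)
  low := fun b θ n hn => c.low b θ n (hn.trans h)

/-- The composition of two coverings. -/
def comp {K : ℕ} {𝒵 𝒴 𝒳 : Arena.{u}} (c : Cover K 𝒴 𝒳) (c' : Cover K 𝒵 𝒴) : Cover K 𝒵 𝒳 where
  π := fun z => c.π (c'.π z)
  nonexp := fun n x y h => c.nonexp n _ _ (c'.nonexp n _ _ h)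
  inj := fun n hn x y h => c'.inj n hn _ _ (c.inj n hn _ _ h)
  surj := fun x => by
    obtain ⟨y, rfl⟩ := c.surj x
    obtain ⟨z, rfl⟩ := c'.surj y
    exact ⟨z, rfl⟩
  φ := fun b θ => c.φ b (c'.φ b θ)
  loc := fun b n θ θ' h => c.loc b n _ _ (c'.loc b n _ _ h)
  low := fun b θ n hn x => by
    rw [c.low b _ n hn x]
    constructor
    · rintro ⟨y, hy, h⟩
      obtain ⟨z, hz, h'⟩ := (c'.low b θ n hn y).1 hy
      exact ⟨z, hz, Arena.trans (c.nonexp n _ _ h') h⟩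
    · rintro ⟨z, hz, h⟩
      exact ⟨c'.π z, (c'.low b θ n hn _).2 ⟨z, hz, 𝒴.refl _ _⟩, h⟩
  lift := fun b θ x h => by
    obtain ⟨y, hy, rfl⟩ := c.lift b _ x h
    obtain ⟨z, hz, rfl⟩ := c'.lift b _ y hy
    exact ⟨z, hz, rfl⟩

section OfWin

variable {𝒴 𝒳 : Arena.{u}}

/-- The board on which a player of parity `b` turns a quasistrategy for `𝒴`, which is revealed
level by level, into a quasistrategy for `𝒳`. -/
abbrev liftBoard (𝒴 𝒳 : Arena.{u}) (b : Bool) : Board (𝒳 × Strat 𝒴 b) where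
  E := fun n p q => 𝒳.E n p.1 q.1 ∧ Strat.Agree n p.2 q.2
  F := fun n p q => 𝒳.E n p.1 q.1 ∧ p.2 = q.2
  equiv := fun _ => ⟨fun _ => ⟨𝒳.refl _ _, Strat.Agree.refl _ _⟩,
    fun h => ⟨Arena.symm h.1, h.2.symm⟩,
    fun h h' => ⟨Arena.trans h.1 h'.1, h.2.trans h'.2⟩⟩
  mono := fun n _ _ h => ⟨𝒳.mono _ _ _ h.1, h.2.anti (Nat.le_succ n)⟩
  sub := fun _ _ _ h => ⟨h.1, h.2 ▸ Strat.Agree.refl _ _⟩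

/-- The pairs of a play `x` of `𝒳` and a quasistrategy `θ` for `𝒴` such that `x` lifts to a play
of `θ`. -/
def liftSet (π : 𝒴 → 𝒳) (b : Bool) : Set (𝒳 × Strat 𝒴 b) :=
  {p | ∃ y, (∀ n, p.2.R n y) ∧ π y = p.1}

variable {K : ℕ} {π : 𝒴 → 𝒳}

theorem exists_liftStrat (nonexp : ∀ n x y, 𝒴.E n x y → 𝒳.E n (π x) (π y))
    (inj : ∀ n ≤ K, ∀ x y, 𝒳.E n (π x) (π y) → 𝒴.E n x y) (surj : ∀ x, ∃ y, π y = x) (b : Bool)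
    (hwin : ∀ (θ : Strat 𝒴 b) x y, θ.R K y → 𝒳.E K (π y) x →
      (liftBoard 𝒴 𝒳 b).Win b (liftSet π b) K (x, θ)) :
    ∃ φ : Strat 𝒴 b → Strat 𝒳 b,
      (∀ n θ θ', Strat.Agree n θ θ' → Strat.Agree n (φ θ) (φ θ')) ∧
      (∀ θ, ∀ n ≤ K, ∀ x, (φ θ).R n x ↔ ∃ y, θ.R n y ∧ 𝒳.E n (π y) x) ∧
      ∀ θ x, (∀ n, (φ θ).R n x) → ∃ y, (∀ n, θ.R n y) ∧ π y = x := by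
  obtain ⟨R, ⟨hresp, hown, hopp⟩, hK, hlim⟩ := Board.glue (B := liftBoard 𝒴 𝒳 b) (b := b)
    (T := liftSet π b) K (fun _ _ => False) (fun _ _ _ _ _ h => h) (fun _ _ _ _ h => h.elim)
    (fun _ _ _ _ h => h.elim) (fun _ h => (h K le_rfl).elim)
  set G : ℕ → 𝒳 × Strat 𝒴 b → Prop := fun n p => ∃ y, p.2.R n y ∧ 𝒳.E n (π y) p.1 with hG
  have hGK : ∀ p, G K p → R K p := fun p ⟨y, h1, h2⟩ => (hK p).2 (Or.inr (hwin p.2 p.1 y h1 h2))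
  have hGresp : ∀ n p q, (liftBoard 𝒴 𝒳 b).E n p q → G n p → G n q := by
    rintro n p q ⟨h1, h2⟩ ⟨y, h3, h4⟩
    exact ⟨y, by rw [← h2 n le_rfl]; exact h3, Arena.trans h4 h1⟩
  have hGmono : ∀ n p, G (n + 1) p → G n p := fun n p ⟨y, h1, h2⟩ =>
    ⟨y, p.2.mono _ _ h1, 𝒳.mono _ _ _ h2⟩
  have hGanti : ∀ m n p, m ≤ n → G n p → G m p := by
    intro m n p h hp
    induction n, h using Nat.le_induction with
    | base => exact hp
    | succ n _ ih => exact ih (hGmono _ _ hp)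
  set Q : ℕ → 𝒳 × Strat 𝒴 b → Prop := fun n p => G (min n K) p ∧ (K ≤ n → R n p) with hQ
  have hQresp : ∀ n p q, (liftBoard 𝒴 𝒳 b).E n p q → Q n p → Q n q := by
    intro n p q h hp
    exact ⟨hGresp _ p q (Board.anti (min_le_left _ _) h) hp.1,
      fun hn => hresp n hn p q h (hp.2 hn)⟩
  have hQown : ∀ n, n.bodd = b → ∀ x θ, Q n (x, θ) → ∃ y, 𝒳.E n x y ∧ Q (n + 1) (y, θ) := by
    intro n hb x θ hx
    rcases Nat.lt_or_ge n K with hn | hn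
    · have h0 := hx.1
      rw [min_eq_left hn.le] at h0
      obtain ⟨y, h1, h2⟩ := h0
      obtain ⟨z, h3, h4⟩ := θ.own n hb y h1
      have h5 : G (n + 1) (π z, θ) := ⟨z, h4, 𝒳.refl _ _⟩
      refine ⟨π z, Arena.trans (Arena.symm h2) (nonexp _ _ _ h3), ?_, fun h => ?_⟩
      · rw [min_eq_left (by omega)]; exact h5
      · obtain rfl : K = n + 1 := by omega
        exact hGK _ h5
    · obtain ⟨⟨y, θ'⟩, ⟨h1, h2⟩, h3⟩ := hown n hn hb _ (hx.2 hn)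
      obtain rfl : θ = θ' := h2
      refine ⟨y, h1, ?_, fun _ => h3⟩
      have h0 := hx.1
      rw [min_eq_right hn] at h0
      rw [min_eq_right (by omega)]
      exact hGresp _ (x, θ) _ ⟨Arena.anti hn h1, Strat.Agree.refl _ _⟩ h0
  have hQopp : ∀ n, n.bodd ≠ b → ∀ p, Q n p → Q (n + 1) p := by
    intro n hb p hp
    have h0 := hp.1
    rcases Nat.lt_or_ge n K with hn | hn
    · rw [min_eq_left hn.le] at h0
      obtain ⟨y, h1, h2⟩ := h0
      obtain ⟨z, hz⟩ := surj p.1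
      have h5 : G (n + 1) p := by
        refine ⟨z, p.2.opp n hb z (p.2.resp n y z (inj n hn.le y z ?_) h1), ?_⟩
        · rw [hz]; exact h2
        · rw [hz]; exact 𝒳.refl _ _
      refine ⟨?_, fun h => ?_⟩
      · rw [min_eq_left (by omega)]; exact h5
      · obtain rfl : K = n + 1 := by omega
        exact hGK _ h5
    · refine ⟨?_, fun _ => hopp n hn hb p (hp.2 hn)⟩
      rw [min_eq_right hn] at h0
      rw [min_eq_right (by omega)]
      exact h0
  have hlow : ∀ n ≤ K, ∀ p, (∀ m ≤ n, Q m p) ↔ G n p := by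
    intro n hn p
    constructor
    · intro h
      have := (h n le_rfl).1
      rwa [min_eq_left hn] at this
    · intro h m hm
      refine ⟨?_, fun hKm => ?_⟩
      · rw [min_eq_left (hm.trans hn)]
        exact hGanti m n p hm h
      · obtain rfl : m = K := by omega
        exact hGK _ (hGanti m n p hm h)
  refine ⟨fun θ =>
    { R := fun n x => ∀ m ≤ n, Q m (x, θ)
      start := ?_, mono := ?_, resp := ?_, own := ?_, opp := ?_ }, ?_, ?_, ?_⟩
  · intro x
    obtain ⟨y, rfl⟩ := surj x
    exact (hlow 0 (Nat.zero_le _) _).2 ⟨y, θ.start y, 𝒳.refl _ _⟩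
  · exact fun n x h m hm => h m (by omega)
  · exact fun n x y h hx m hm => hQresp m (x, θ) _ ⟨Arena.anti hm h, Strat.Agree.refl _ _⟩ (hx m hm)
  · intro n hb x hx
    obtain ⟨y, h1, h2⟩ := hQown n hb x θ (hx n le_rfl)
    refine ⟨y, h1, fun m hm => ?_⟩
    rcases Nat.lt_or_ge n m with h | h
    · obtain rfl : m = n + 1 := by omega
      exact h2
    · exact hQresp m (x, θ) _ ⟨Arena.anti h h1, Strat.Agree.refl _ _⟩ (hx m h)
  · intro n hb x hx m hm
    rcases Nat.lt_or_ge n m with h | h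
    · obtain rfl : m = n + 1 := by omega
      exact hQopp n hb _ (hx n le_rfl)
    · exact hx m h
  · intro n θ θ' h m hm
    funext x
    refine propext (forall₂_congr fun i hi => ?_)
    have hE : (liftBoard 𝒴 𝒳 b).E i (x, θ) (x, θ') := ⟨𝒳.refl _ _, h.anti (hi.trans hm)⟩
    exact ⟨hQresp i _ _ hE, hQresp i _ _ (Board.symm hE)⟩
  · exact fun θ n hn x => hlow n hn (x, θ)
  · exact fun θ x h => hlim (x, θ) fun n hn => (h n n le_rfl).2 hn

/-- A map of arenas is a covering if quasistrategies can be transferred from level `K` on. -/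
theorem exists_of_win (π : 𝒴 → 𝒳) (nonexp : ∀ n x y, 𝒴.E n x y → 𝒳.E n (π x) (π y))
    (inj : ∀ n ≤ K, ∀ x y, 𝒳.E n (π x) (π y) → 𝒴.E n x y) (surj : ∀ x, ∃ y, π y = x)
    (hwin : ∀ (b : Bool) (θ : Strat 𝒴 b) x y, θ.R K y → 𝒳.E K (π y) x →
      (liftBoard 𝒴 𝒳 b).Win b (liftSet π b) K (x, θ)) :
    ∃ c : Cover K 𝒴 𝒳, c.π = π := by
  choose φ h1 h2 h3 using fun b => exists_liftStrat nonexp inj surj b (hwin b)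
  exact ⟨⟨π, nonexp, inj, surj, φ, h1, h2, h3⟩, rfl⟩

end OfWin

end Cover

namespace Unfold

variable {𝒳 : Arena.{u}}

/-- The legal pairs of auxiliary moves in Martin's auxiliary game for the closed set `A`: at level
`K` the player to move announces a quasistrategy `S` of his own, and at level `K + 1` the other one
restricts the play to a set `S'` that either is a position of `S` outside of `A`, or is a
quasistrategy of his within `S` that lies inside `A`. -/
structure Legal (A : Set 𝒳) (K : ℕ) (S S' : Set 𝒳) (x : 𝒳) : Prop where
  closed : 𝒳.ClosedSet S
  closedFrom : 𝒳.ClosedFrom false (K + 1) S Set.univ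
  level : ∀ y ∈ S, 𝒳.E (K + 1) x y
  closed' : 𝒳.ClosedSet S'
  level' : ∀ y ∈ S', 𝒳.E (K + 2) x y
  mem : x ∈ S'
  option : (∃ j, K + 2 ≤ j ∧ S' = {y | 𝒳.E j x y} ∧ (∃ y ∈ S, 𝒳.E j x y) ∧ ∀ y ∈ S', y ∉ A) ∨
    (S' ⊆ S ∧ S' ⊆ A ∧ 𝒳.ClosedFrom true (K + 2) S' S)

variable {A S S' : Set 𝒳} {K : ℕ} {x y : 𝒳}

theorem Legal.of_mem (h : Legal A K S S' x) (hy : y ∈ S') : Legal A K S S' y where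
  closed := h.closed
  closedFrom := h.closedFrom
  level := fun z hz => Arena.trans (Arena.symm (𝒳.mono _ _ _ (h.level' y hy))) (h.level z hz)
  closed' := h.closed'
  level' := fun z hz => Arena.trans (Arena.symm (h.level' y hy)) (h.level' z hz)
  mem := hy
  option := by
    refine h.option.imp_left ?_
    rintro ⟨j, hj, rfl, ⟨z, hz, hxz⟩, hA⟩
    have hyx := Arena.symm (show 𝒳.E j x y from hy)
    refine ⟨j, hj, ?_, ⟨z, hz, Arena.trans hyx hxz⟩, hA⟩
    ext z
    exact ⟨fun h1 => Arena.trans hyx h1, fun h1 => Arena.trans hy h1⟩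

theorem closedSet_class (n : ℕ) (x : 𝒳) : 𝒳.ClosedSet {y | 𝒳.E n x y} := by
  intro y hy
  obtain ⟨z, hz, h⟩ := hy n
  exact Arena.trans hz (Arena.symm h)

theorem closedFrom_class (b : Bool) (n : ℕ) (x : 𝒳) :
    𝒳.ClosedFrom b n {y | 𝒳.E n x y} Set.univ := fun _ hm _ _ hz y _ hzy =>
  ⟨y, Arena.trans hz (Arena.anti hm hzy), 𝒳.refl _ _⟩

theorem Legal.of_notMem (hS : 𝒳.ClosedSet S) (hSb : 𝒳.ClosedFrom false (K + 1) S Set.univ)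
    (hSl : ∀ z ∈ S, 𝒳.E (K + 1) y z) (hy : y ∈ S) {j : ℕ} (hj : K + 2 ≤ j)
    (hA : ∀ z, 𝒳.E j y z → z ∉ A) : Legal A K S {z | 𝒳.E j y z} y where
  closed := hS
  closedFrom := hSb
  level := hSl
  closed' := closedSet_class j y
  level' := fun _ h => Arena.anti hj h
  mem := 𝒳.refl _ _
  option := Or.inl ⟨j, hj, rfl, ⟨y, hy, 𝒳.refl _ _⟩, hA⟩

theorem exists_legal (hA : ∀ y, y ∉ A → ∃ j, ∀ z, 𝒳.E j y z → z ∉ A)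
    (hS : 𝒳.ClosedSet S) (hSb : 𝒳.ClosedFrom false (K + 1) S Set.univ)
    (hSl : ∀ z ∈ S, 𝒳.E (K + 1) x z) (hx : x ∈ S) : ∃ y S', Legal A K S S' y := by
  by_cases h : ∃ y ∈ S, y ∉ A
  · obtain ⟨y, hy, hyA⟩ := h
    obtain ⟨j, hj⟩ := hA y hyA
    exact ⟨y, _, Legal.of_notMem hS hSb
      (fun z hz => Arena.trans (Arena.symm (hSl y hy)) (hSl z hz)) hy (le_max_right j (K + 2))
      fun z hz => hj z (Arena.anti (le_max_left _ _) hz)⟩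
  · push Not at h
    refine ⟨x, {z | z ∈ S ∧ 𝒳.E (K + 2) x z}, hS, hSb, hSl, hS.inter_class _ _, fun _ h => h.2,
      ⟨hx, 𝒳.refl _ _⟩, Or.inr ⟨fun z hz => hz.1, fun z hz => h z hz.1, ?_⟩⟩
    intro n hn _ z hz y hy hzy
    exact ⟨y, ⟨hy, Arena.trans hz.2 (Arena.anti hn hzy)⟩, 𝒳.refl _ _⟩

theorem exists_legal_mem (hA : ∀ y, y ∉ A → ∃ j, ∀ z, 𝒳.E j y z → z ∉ A) (K : ℕ) (x : 𝒳) :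
    ∃ S S', Legal A K S S' x := by
  by_cases hx : x ∈ A
  · set S : Set 𝒳 := {y | 𝒳.E (K + 1) x y ∧
      ∀ n, K + 1 ≤ n → n.bodd = false → 𝒳.E n x y → 𝒳.E (n + 1) x y} with hSdef
    have hxS : x ∈ S := ⟨𝒳.refl _ _, fun _ _ _ _ => 𝒳.refl _ _⟩
    refine ⟨S, {x}, ?_, ?_, fun y hy => hy.1, ?_, ?_, rfl, Or.inr ⟨?_, ?_, ?_⟩⟩
    · intro y hy
      refine ⟨?_, fun n hn hb h => ?_⟩
      · obtain ⟨z, hz, h⟩ := hy (K + 1)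
        exact Arena.trans hz.1 (Arena.symm h)
      · obtain ⟨z, hz, h'⟩ := hy (n + 1)
        exact Arena.trans (hz.2 n hn hb (Arena.trans h (𝒳.mono _ _ _ h'))) (Arena.symm h')
    · intro n hn hb z hz y _ hzy
      by_cases hxy : 𝒳.E (n + 1) x y
      · exact ⟨x, hxS, Arena.symm hxy⟩
      · refine ⟨y, ⟨Arena.trans hz.1 (Arena.anti hn hzy), fun m hm hmb h => ?_⟩, 𝒳.refl _ _⟩
        rcases lt_trichotomy m n with h1 | rfl | h1
        · have h2 := hz.2 m hm hmb (Arena.trans h (Arena.symm (Arena.anti h1.le hzy)))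
          exact Arena.trans h2 (Arena.anti h1 hzy)
        · exact absurd hmb hb
        · exact absurd (Arena.anti h1 h) hxy
    · intro y hy
      refine (𝒳.sep _ _ fun n => ?_ : y = x)
      obtain ⟨z, rfl, h⟩ := hy n
      exact h
    · rintro _ rfl
      exact 𝒳.refl _ _
    · rintro _ rfl
      exact hxS
    · rintro _ rfl
      exact hx
    · rintro n hn hb _ rfl y hy hxy
      have hb' : n.bodd = false := by simpa using hb
      exact ⟨_, rfl, Arena.symm (hy.2 n (by omega) hb' hxy)⟩
  · obtain ⟨j, hj⟩ := hA x hx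
    exact ⟨_, _, Legal.of_notMem (closedSet_class (K + 1) x) (closedFrom_class _ _ _)
      (fun _ h => h) (𝒳.refl _ _) (le_max_right j (K + 2))
      fun z hz => hj z (Arena.anti (le_max_left _ _) hz)⟩

/-- Martin's auxiliary game for the set `A`, with auxiliary moves at levels `K` and `K + 1`. -/
def arena (𝒳 : Arena.{u}) (A : Set 𝒳) (K : ℕ) : Arena.{u} where
  X := {t : 𝒳 × Set 𝒳 × Set 𝒳 // Legal A K t.2.1 t.2.2 t.1}
  E := fun n s t => 𝒳.E n s.1.1 t.1.1 ∧ (K < n → s.1.2.1 = t.1.2.1) ∧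
    (K + 1 < n → s.1.2.2 = t.1.2.2)
  equiv := fun n => ⟨fun s => ⟨𝒳.refl _ _, fun _ => rfl, fun _ => rfl⟩,
    fun h => ⟨Arena.symm h.1, fun hn => (h.2.1 hn).symm, fun hn => (h.2.2 hn).symm⟩,
    fun h h' => ⟨Arena.trans h.1 h'.1, fun hn => (h.2.1 hn).trans (h'.2.1 hn),
      fun hn => (h.2.2 hn).trans (h'.2.2 hn)⟩⟩
  mono := fun n _ _ h => ⟨𝒳.mono _ _ _ h.1, fun hn => h.2.1 (by omega), fun hn => h.2.2 (by omega)⟩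
  zero := fun _ _ => ⟨𝒳.zero _ _, fun h => absurd h (by omega), fun h => absurd h (by omega)⟩
  sep := by
    rintro ⟨⟨x, S, S'⟩, h⟩ ⟨⟨y, T, T'⟩, h'⟩ hE
    obtain rfl : x = y := 𝒳.sep _ _ fun n => (hE n).1
    obtain rfl : S = T := (hE (K + 1)).2.1 (by omega)
    obtain rfl : S' = T' := (hE (K + 2)).2.2 (by omega)
    rfl
  complete := by
    intro t ht
    obtain ⟨y, hy⟩ := 𝒳.complete (fun n => (t n).1.1) fun n => (ht n).1
    have h1 : ∀ n, K + 2 ≤ n → (t n).1.2 = (t (K + 2)).1.2 := by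
      intro n hn
      induction n, hn using Nat.le_induction with
      | base => rfl
      | succ n hn ih =>
        rw [← ih]
        exact Prod.ext ((ht n).2.1 (by omega)).symm ((ht n).2.2 (by omega)).symm
    have hy' : y ∈ (t (K + 2)).1.2.2 := by
      refine (t (K + 2)).2.closed' y fun n => ⟨(t (max n (K + 2))).1.1, ?_, ?_⟩
      · rw [← h1 _ (le_max_right n (K + 2))]
        exact (t (max n (K + 2))).2.mem
      · exact Arena.anti (le_max_left _ _) (hy _)
    refine ⟨⟨(y, (t (K + 2)).1.2), (t (K + 2)).2.of_mem hy'⟩, fun n => ⟨hy n, fun hn => ?_,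
      fun hn => ?_⟩⟩
    · rcases Nat.lt_or_ge n (K + 2) with h | h
      · obtain rfl : n = K + 1 := by omega
        exact ((ht (K + 1)).2.1 (by omega)).symm
      · rw [h1 n h]
    · rw [h1 n hn]

/-- The projection of the auxiliary game. -/
abbrev proj (𝒳 : Arena.{u}) (A : Set 𝒳) (K : ℕ) (t : arena 𝒳 A K) : 𝒳 := t.1.1

section Transfer

variable {b : Bool} {θ₀ : Strat (arena 𝒳 A K) b}

/-- Player `b` can force, from the level-`n` position of `x`, that the play lifts to a play of the
quasistrategy `θ` for the auxiliary game. -/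
def LiftWin (n : ℕ) (x : 𝒳) (θ : Strat (arena 𝒳 A K) b) : Prop :=
  (Cover.liftBoard (arena 𝒳 A K) 𝒳 b).Win b (Cover.liftSet (proj 𝒳 A K) b) n (x, θ)

theorem LiftWin.resp {n : ℕ} {θ : Strat (arena 𝒳 A K) b} (h : LiftWin n x θ) (hxy : 𝒳.E n x y) :
    LiftWin n y θ := by
  unfold LiftWin
  have hE : (Cover.liftBoard (arena 𝒳 A K) 𝒳 b).E n (x, θ) (y, θ) := ⟨hxy, Strat.Agree.refl _ _⟩
  exact Board.Win.resp hE h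

/-- Once the auxiliary moves are made, player `b` just follows `θ`. -/
theorem liftWin_of_follow {j : ℕ} (hj : K + 2 ≤ j)
    (hopp : ∀ n, j ≤ n → n.bodd ≠ b → ∀ z ∈ S', ∀ y θ, 𝒳.E n z y → Strat.Agree (K + 2) θ θ₀ →
      (∃ w ∈ S', 𝒳.E (n + 1) y w) ∨ LiftWin (n + 1) y θ)
    (t : arena 𝒳 A K) (ht : θ₀.R j t) (hS' : t.1.2.2 = S')
    (htx : 𝒳.E j t.1.1 x) : LiftWin j x θ₀ := by
  subst hS'
  refine Board.Win.of_glue (fun n p => Strat.Agree (K + 2) p.2 θ₀ ∧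
    ∃ s : arena 𝒳 A K, p.2.R n s ∧ s.1.2 = t.1.2 ∧ 𝒳.E n s.1.1 p.1) ?_ ?_ ?_ ?_
    ⟨Strat.Agree.refl _ _, t, ht, rfl, htx⟩
  · rintro n hn ⟨y, θ⟩ ⟨z, θ'⟩ ⟨h1, h2⟩ ⟨h3, s, h4, h5, h6⟩
    refine ⟨(h2.anti (hj.trans hn)).symm.trans h3, s, ?_, h5, Arena.trans h6 h1⟩
    rw [← h2 n le_rfl]
    exact h4
  · rintro n hn hb ⟨y, θ⟩ ⟨h3, s, h4, h5, h6⟩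
    obtain ⟨s', h7, h8⟩ := θ.own n hb s h4
    refine ⟨(s'.1.1, θ), ⟨Arena.trans (Arena.symm h6) h7.1, rfl⟩, Or.inl ⟨h3, s', h8, ?_,
      𝒳.refl _ _⟩⟩
    rw [← h5]
    exact Prod.ext (h7.2.1 (by omega)).symm (h7.2.2 (by omega)).symm
  · rintro n hn hb ⟨y, θ⟩ ⟨h3, s, h4, h5, h6⟩
    have hs : s.1.1 ∈ t.1.2.2 := h5 ▸ s.2.mem
    refine (hopp n hn hb s.1.1 hs y θ h6 h3).imp_left ?_
    rintro ⟨w, hw, hyw⟩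
    rw [← h5] at hw
    refine ⟨h3, ⟨(w, s.1.2), s.2.of_mem hw⟩, ?_, h5, Arena.symm hyw⟩
    refine θ.opp n hb _ (θ.resp n s _ ⟨?_, fun _ => rfl, fun _ => rfl⟩ h4)
    exact Arena.trans h6 (𝒳.mono _ _ _ hyw)
  · rintro ⟨y, θ⟩ h
    left
    have hy : y ∈ t.1.2.2 := by
      refine t.2.closed' y fun n => ?_
      obtain ⟨-, s, -, h5, h6⟩ := h (max n j) (le_max_right _ _)
      exact ⟨s.1.1, h5 ▸ s.2.mem, Arena.symm (Arena.anti (le_max_left _ _) h6)⟩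
    refine ⟨⟨(y, t.1.2), t.2.of_mem hy⟩, fun n => ?_, rfl⟩
    obtain ⟨-, s, h4, h5, h6⟩ := h (max n j) (le_max_right _ _)
    refine θ.anti (le_max_left n j) (θ.resp _ s _ ⟨h6, fun _ => ?_, fun _ => ?_⟩ h4)
    · rw [h5]
    · rw [h5]

/-- Player `b` may first force a set `T` of plays on which he will be able to lift the play. -/
theorem liftWin_of_win {T : Set 𝒳} {n : ℕ} (hn : K + 2 ≤ n) {θ : Strat (arena 𝒳 A K) b}
    (hT : ∀ y ∈ T, 𝒳.E n x y → ∀ θ', Strat.Agree (K + 2) θ' θ → ∃ j, n ≤ j ∧ LiftWin j y θ')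
    (hx : 𝒳.board.Win b T n x) : LiftWin n x θ := by
  obtain ⟨R, ⟨hresp, hown, hopp⟩, hR, hlim⟩ := hx
  refine Board.Win.of_glue (fun m p => Strat.Agree (K + 2) p.2 θ ∧ R m p.1 ∧ 𝒳.E n x p.1)
    ?_ ?_ ?_ ?_ ⟨Strat.Agree.refl _ _, hR, 𝒳.refl _ _⟩
  · rintro m hm ⟨y, θ₁⟩ ⟨z, θ₂⟩ ⟨h1, h2⟩ ⟨h3, h4, h5⟩
    exact ⟨(h2.anti (hn.trans hm)).symm.trans h3, hresp m hm _ _ h1 h4,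
      Arena.trans h5 (Arena.anti hm h1)⟩
  · rintro m hm hb ⟨y, θ₁⟩ ⟨h3, h4, h5⟩
    obtain ⟨z, h6, h7⟩ := hown m hm hb y h4
    exact ⟨(z, θ₁), ⟨h6, rfl⟩, Or.inl ⟨h3, h7, Arena.trans h5 (Arena.anti hm h6)⟩⟩
  · rintro m hm hb ⟨y, θ₁⟩ ⟨h3, h4, h5⟩
    exact Or.inl ⟨h3, hopp m hm hb y h4, h5⟩
  · rintro ⟨y, θ₁⟩ h
    right
    obtain ⟨h1, -, h2⟩ := h n le_rfl
    exact hT y (hlim y fun m hm => (h m hm).2.1) h2 θ₁ h1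

/-- If the auxiliary set `S'` is a position, then player `b` just follows `θ` from there on. -/
theorem liftWin_of_position {j : ℕ} (hj : K + 2 ≤ j) {t : arena 𝒳 A K} (ht : θ₀.R (K + 2) t)
    (hS' : t.1.2.2 = {y | 𝒳.E j t.1.1 y}) (hx : 𝒳.E j t.1.1 x) : LiftWin j x θ₀ := by
  obtain ⟨s, hts, hs⟩ := θ₀.extend hj ht
  have h2 : s.1.2.2 = {y | 𝒳.E j t.1.1 y} := by rw [← hS', hts.2.2 (by omega)]
  have h3 : s.1.1 ∈ {y | 𝒳.E j t.1.1 y} := h2 ▸ s.2.mem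
  refine liftWin_of_follow hj (fun n hn _ z hz y θ hzy _ => Or.inl ⟨y, ?_, 𝒳.refl _ _⟩) s hs h2
    (Arena.trans (Arena.symm h3) hx)
  exact Arena.trans hz (Arena.anti hn hzy)

theorem liftWin_false (hA : ∀ y, y ∉ A → ∃ j, ∀ z, 𝒳.E j y z → z ∉ A) (hK : K.bodd = false)
    (θ : Strat (arena 𝒳 A K) false) (t : arena 𝒳 A K) (ht : θ.R K t) (htx : 𝒳.E K t.1.1 x) :
    LiftWin K x θ := by
  have hK1 : (K + 1).bodd ≠ false := by simp [hK]
  have key : ∀ (θ : Strat (arena 𝒳 A K) false) (t : arena 𝒳 A K) x, θ.R (K + 1) t →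
      𝒳.E (K + 1) t.1.1 x → LiftWin (K + 2) x θ := by
    intro θ t x ht htx
    set S := t.1.2.1 with hS
    have hSc := t.2.closed
    have hSb := t.2.closedFrom
    have hR : ∀ (θ' : Strat (arena 𝒳 A K) false), Strat.Agree (K + 2) θ' θ →
        ∀ y S' (h : Legal A K S S' y), θ'.R (K + 2) ⟨(y, S, S'), h⟩ := by
      intro θ' hθ y S' h
      refine θ'.opp (K + 1) hK1 _ (θ'.resp _ t _ ⟨?_, fun _ => rfl, fun h => by omega⟩ ?_)
      · have h1 := h.level' y h.mem
        obtain ⟨z, hz⟩ : ∃ z, z ∈ S := by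
          rcases h.option with ⟨-, -, -, ⟨z, hz, -⟩, -⟩ | ⟨h2, -⟩
          · exact ⟨z, hz⟩
          · exact ⟨y, h2 h.mem⟩
        exact Arena.trans (t.2.level z hz) (Arena.symm (h.level z hz))
      · rw [hθ _ (Nat.le_succ _)]
        exact ht
    have hreach : ∀ n, K + 2 ≤ n → ∀ y θ', Strat.Agree (K + 2) θ' θ →
        𝒳.board.Win false (S \ A) n y → LiftWin n y θ' := by
      intro n hn y θ' hθ hw
      refine liftWin_of_win hn (fun z hz _ θ'' hθ' => ?_) hw
      obtain ⟨j, hj⟩ := hA z hz.2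
      have hl : Legal A K S {w | 𝒳.E (max j n) z w} z := by
        exact Legal.of_notMem hSc hSb
          (fun w hw => Arena.trans (Arena.symm (t.2.level z hz.1)) (t.2.level w hw)) hz.1
          (hn.trans (le_max_right _ _)) fun w hw => hj w (Arena.anti (le_max_left _ _) hw)
      exact ⟨max j n, le_max_right _ _, liftWin_of_position (hn.trans (le_max_right _ _))
        (hR θ'' (hθ'.trans hθ) z _ hl) rfl (𝒳.refl _ _)⟩
    obtain ⟨w, hw, hxw⟩ : ∃ w ∈ S, 𝒳.E (K + 2) x w := by
      rcases t.2.option with ⟨j, hj, hS', ⟨z, hz, htz⟩, -⟩ | ⟨h2, -⟩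
      · exact hSb (K + 1) le_rfl hK1 z hz x trivial
          (Arena.trans (Arena.symm (Arena.anti (by omega) htz)) htx)
      · exact hSb (K + 1) le_rfl hK1 t.1.1 (h2 t.2.mem) x trivial htx
    have hwS : ∀ z ∈ S, 𝒳.E (K + 1) w z := fun z hz =>
      Arena.trans (Arena.symm (t.2.level w hw)) (t.2.level z hz)
    by_cases hwin : 𝒳.board.Win false (S \ A) (K + 2) w
    · exact (hreach _ le_rfl w θ (Strat.Agree.refl _ _) hwin).resp (Arena.symm hxw)
    have hSb2 : 𝒳.ClosedFrom false (K + 2) S Set.univ := fun n hn => hSb n (by omega)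
    obtain ⟨u, hu, hwu, hu'⟩ := Arena.exists_avoid hSc hSb2 ⟨w, hw, 𝒳.refl _ _⟩ hwin
    have huS : u ∈ 𝒳.avoid false (S \ A) S (K + 2) w := ⟨hu, hwu, hu'⟩
    have hl : Legal A K S (𝒳.avoid false (S \ A) S (K + 2) w) u := by
      refine ⟨hSc, hSb, fun z hz => Arena.trans (Arena.symm (hwS u hu)) (hwS z hz), hSc.avoid w,
        fun z hz => Arena.trans (Arena.symm hwu) hz.2.1, huS, Or.inr ⟨fun z hz => hz.1,
        fun z hz => ?_, Arena.closedFrom_avoid hSc hSb2 w⟩⟩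
      by_contra hzA
      obtain ⟨j, hj⟩ := hA z hzA
      refine hz.2.2 (max j (K + 2)) (le_max_right _ _) (Arena.win_of_subset hSc
        (fun n hn => hSb2 n ((le_max_right _ _).trans hn)) hz.1 fun v hv hzv =>
        ⟨hv, hj v (Arena.anti (le_max_left _ _) hzv)⟩)
    refine liftWin_of_follow (S' := 𝒳.avoid false (S \ A) S (K + 2) w) le_rfl ?_ _
      (hR θ (Strat.Agree.refl _ _) u _ hl) rfl (Arena.symm (Arena.trans hxw hwu))
    intro n hn hb z hz y θ' hzy hθ
    by_cases hwin' : 𝒳.board.Win false (S \ A) (n + 1) y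
    · exact Or.inr (hreach _ (by omega) y θ' hθ hwin')
    · exact Or.inl (Arena.exists_avoid_succ hSc hSb2 hn hz hzy
        (hSb2 n hn hb z hz.1 y trivial hzy) hwin')
  refine Board.Win.of_glue (fun n p => (n = K ∨ n = K + 1) ∧ ∃ s : arena 𝒳 A K, p.2.R n s ∧
    𝒳.E n s.1.1 p.1) ?_ ?_ ?_ ?_ ⟨Or.inl rfl, t, ht, htx⟩
  · rintro n hn ⟨y, θ⟩ ⟨z, θ'⟩ ⟨h1, h2⟩ ⟨h3, s, h4, h5⟩
    exact ⟨h3, s, by rw [← h2 n le_rfl]; exact h4, Arena.trans h5 h1⟩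
  · rintro n hn hb ⟨y, θ⟩ ⟨rfl | rfl, s, h4, h5⟩
    · obtain ⟨s', h6, h7⟩ := θ.own _ hb s h4
      exact ⟨(s'.1.1, θ), ⟨Arena.trans (Arena.symm h5) h6.1, rfl⟩,
        Or.inl ⟨Or.inr rfl, s', h7, 𝒳.refl _ _⟩⟩
    · exact absurd hb hK1
  · rintro n hn hb ⟨y, θ⟩ ⟨rfl | rfl, s, h4, h5⟩
    · exact absurd hK hb
    · exact Or.inr (key θ s y h4 h5)
  · intro p hp
    have := (hp (K + 2) (by omega)).1
    omega

theorem liftWin_true (hA : ∀ y, y ∉ A → ∃ j, ∀ z, 𝒳.E j y z → z ∉ A) (hK : K.bodd = false)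
    (θ : Strat (arena 𝒳 A K) true) (t : arena 𝒳 A K) (ht : θ.R K t) (htx : 𝒳.E K t.1.1 x) :
    LiftWin K x θ := by
  have hK0 : K.bodd ≠ true := by simp [hK]
  have hK1 : (K + 1).bodd = true := by simp [hK]
  have key : ∀ (θ : Strat (arena 𝒳 A K) true) (t : arena 𝒳 A K) x, θ.R K t →
      𝒳.E K t.1.1 x → ∃ y, 𝒳.E (K + 1) x y ∧ LiftWin (K + 2) y θ := by
    intro θ t x ht htx
    set U : ℕ → 𝒳 → Prop := fun j y => K + 2 ≤ j ∧ ∃ s : arena 𝒳 A K, θ.R (K + 2) s ∧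
      s.1.2.2 = {z | 𝒳.E j s.1.1 z} ∧ 𝒳.E j s.1.1 y with hU
    set O : Set 𝒳 := {y | ∃ j, U j y} with hO
    have hUwin : ∀ j y, U j y → 𝒳.board.Win true O j y := fun j y ⟨h1, s, h2, h3, h4⟩ =>
      Arena.win_of_subset (closedSet_class j y) (closedFrom_class _ _ _) (𝒳.refl _ _)
        fun z _ hz => ⟨j, h1, s, h2, h3, Arena.trans h4 hz⟩
    have hreach : ∀ n, K + 2 ≤ n → ∀ y, (∀ m, K + 2 ≤ m → m < n → ¬ 𝒳.board.Win true O m y) →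
        ∀ θ', Strat.Agree (K + 2) θ' θ → 𝒳.board.Win true O n y → LiftWin n y θ' := by
      intro n hn y hy θ' hθ hw
      refine liftWin_of_win hn (fun z hz hyz θ'' hθ' => ?_) hw
      obtain ⟨j, hj⟩ := hz
      have hjn : n ≤ j := by
        by_contra! hjn
        exact hy j hj.1 hjn ((hUwin j z hj).resp (B := 𝒳.board)
          (Arena.symm (Arena.anti hjn.le hyz)))
      obtain ⟨h1, s, h2, h3, h4⟩ := hj
      refine ⟨j, hjn, liftWin_of_position h1 (t := s) ?_ h3 h4⟩
      rw [(hθ'.trans hθ) _ le_rfl]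
      exact h2
    by_cases hwin : 𝒳.board.Win true O (K + 1) x
    · obtain ⟨y, hy, hy'⟩ := hwin.own hK1
      exact ⟨y, hy, hreach _ le_rfl y (fun m h1 h2 => by omega) θ (Strat.Agree.refl _ _) hy'⟩
    set S₀ : Set 𝒳 := {y | 𝒳.E (K + 1) x y} with hS₀
    have hS₀c : 𝒳.ClosedSet S₀ := closedSet_class _ _
    have hS₀b : 𝒳.ClosedFrom true (K + 1) S₀ Set.univ := closedFrom_class _ _ _
    set S := 𝒳.avoid true O S₀ (K + 1) x with hS
    have hSc : 𝒳.ClosedSet S := hS₀c.avoid x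
    have hSb : 𝒳.ClosedFrom false (K + 1) S Set.univ := fun n hn hb z hz y _ hzy =>
      Arena.closedFrom_avoid hS₀c hS₀b x n hn hb z hz y
        (Arena.trans hz.1 (Arena.anti hn hzy)) hzy
    obtain ⟨u, hu, hxu, hu'⟩ := Arena.exists_avoid hS₀c hS₀b ⟨x, 𝒳.refl _ _, 𝒳.refl _ _⟩ hwin
    have huS : u ∈ S := ⟨hu, hxu, hu'⟩
    obtain ⟨v, S'', hl⟩ := exists_legal hA hSc hSb
      (fun z hz => Arena.trans (Arena.symm hxu) hz.1) huS
    have hxv : 𝒳.E (K + 1) x v :=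
      Arena.trans hxu (Arena.symm (hl.level u huS))
    obtain ⟨t', hvt', ht'⟩ := θ.own (K + 1) hK1 _ (θ.opp K hK0 _ (θ.resp K t ⟨(v, S, S''), hl⟩
      ⟨Arena.trans htx (𝒳.mono _ _ _ hxv), fun h => by omega, fun h => by omega⟩ ht))
    have hS' : S = t'.1.2.1 := hvt'.2.1 (by omega)
    refine ⟨t'.1.1, Arena.trans hxv hvt'.1, ?_⟩
    rcases t'.2.option with ⟨j, hj, h1, ⟨z, hz, htz⟩, -⟩ | ⟨h1, -, h2⟩
    · rw [← hS'] at hz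
      exact absurd (hUwin j z ⟨hj, t', ht', h1, htz⟩) (hz.2.2 j (by omega))
    · rw [← hS'] at h1 h2
      refine liftWin_of_follow le_rfl ?_ t' ht' rfl (𝒳.refl _ _)
      intro n hn hb z hz y θ' hzy hθ
      by_cases hwin' : 𝒳.board.Win true O (n + 1) y
      · refine Or.inr (hreach _ (by omega) y (fun m h3 h4 h5 => ?_) θ' hθ hwin')
        exact (h1 hz).2.2 m (by omega)
          (h5.resp (B := 𝒳.board) (Arena.symm (Arena.anti (by omega) hzy)))
      · obtain ⟨u', hu', hyu⟩ := Arena.exists_avoid_succ hS₀c hS₀b (by omega) (h1 hz) hzy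
          ⟨y, Arena.trans (h1 hz).1 (Arena.anti (by omega) hzy), 𝒳.refl _ _⟩ hwin'
        obtain ⟨w, hw, huw⟩ := h2 n hn hb z hz u' hu' (Arena.trans hzy (𝒳.mono _ _ _ hyu))
        exact Or.inl ⟨w, hw, Arena.trans hyu huw⟩
  refine Board.Win.of_glue (fun n p => (n = K ∨ n = K + 1) ∧ ∃ s : arena 𝒳 A K, p.2.R K s ∧
    𝒳.E K s.1.1 p.1) ?_ ?_ ?_ ?_ ⟨Or.inl rfl, t, ht, htx⟩
  · rintro n hn ⟨y, θ⟩ ⟨z, θ'⟩ ⟨h1, h2⟩ ⟨h3, s, h4, h5⟩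
    exact ⟨h3, s, by rw [← h2 K hn]; exact h4, Arena.trans h5 (Arena.anti hn h1)⟩
  · rintro n hn hb ⟨y, θ⟩ ⟨rfl | rfl, s, h4, h5⟩
    · exact absurd hb hK0
    · obtain ⟨z, hz, hz'⟩ := key θ s y h4 h5
      exact ⟨(z, θ), ⟨hz, rfl⟩, Or.inr hz'⟩
  · rintro n hn hb ⟨y, θ⟩ ⟨rfl | rfl, s, h4, h5⟩
    · exact Or.inl ⟨Or.inr rfl, s, h4, h5⟩
    · exact absurd hK1 hb
  · intro p hp
    have := (hp (K + 2) (by omega)).1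
    omega

end Transfer

end Unfold

namespace Unfold

variable {𝒳 : Arena.{u}} {A : Set 𝒳} {K : ℕ}

theorem exists_cover (hA : ∀ y, y ∉ A → ∃ j, ∀ z, 𝒳.E j y z → z ∉ A) (hK : K.bodd = false) :
    ∃ c : Cover K (arena 𝒳 A K) 𝒳, c.π = proj 𝒳 A K := by
  refine Cover.exists_of_win (proj 𝒳 A K) (fun _ _ _ h => h.1)
    (fun n hn x y h => ⟨h, fun h => by omega, fun h => by omega⟩) (fun x => ?_) ?_
  · obtain ⟨S, S', h⟩ := exists_legal_mem hA K x
    exact ⟨⟨(x, S, S'), h⟩, rfl⟩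
  · rintro (_ | _) θ x t ht htx
    · exact liftWin_false hA hK θ t ht htx
    · exact liftWin_true hA hK θ t ht htx

theorem mem_of_level {s t : arena 𝒳 A K} (h : (arena 𝒳 A K).E (K + 2) s t) (hs : s.1.1 ∈ A) :
    t.1.1 ∈ A := by
  have hS : s.1.2.2 = t.1.2.2 := h.2.2 (by omega)
  rcases s.2.option with ⟨-, -, -, -, h1⟩ | ⟨-, h1, -⟩
  · exact absurd hs (h1 _ s.2.mem)
  · exact h1 (hS ▸ t.2.mem)

end Unfold

/-- For every `K` there is a covering of `𝒳`, the identity up to level `K`, in which membership in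
`A` is decided at some finite level. -/
def Unravelable (𝒳 : Arena.{u}) (A : Set 𝒳) : Prop :=
  ∀ K, ∃ (𝒴 : Arena.{u}) (c : Cover K 𝒴 𝒳) (m : ℕ), ∀ x y, 𝒴.E m x y → c.π x ∈ A → c.π y ∈ A

namespace Unravelable

variable {𝒳 : Arena.{u}} {A : Set 𝒳}

theorem compl (h : Unravelable 𝒳 A) : Unravelable 𝒳 Aᶜ := by
  intro K
  obtain ⟨𝒴, c, m, hm⟩ := h K
  exact ⟨𝒴, c, m, fun x y hxy hx hy => hx (hm y x (Arena.symm hxy) hy)⟩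

theorem of_closed (hA : ∀ y, y ∉ A → ∃ j, ∀ z, 𝒳.E j y z → z ∉ A) : Unravelable 𝒳 A := by
  intro K
  obtain ⟨c, hc⟩ := Unfold.exists_cover (K := 2 * K) hA (by simp)
  refine ⟨_, c.ofLE (by omega), 2 * K + 2, fun x y hxy => ?_⟩
  have h : (c.ofLE (J := K) (by omega)).π = Unfold.proj 𝒳 A (2 * K) := hc
  rw [h]
  exact Unfold.mem_of_level hxy

theorem of_open (hA : ∀ y ∈ A, ∃ j, ∀ z, 𝒳.E j y z → z ∈ A) : Unravelable 𝒳 A := by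
  rw [← compl_compl A]
  refine (of_closed fun y hy => ?_).compl
  obtain ⟨j, hj⟩ := hA y (by simpa using hy)
  exact ⟨j, fun z hz => by simpa using hj z hz⟩

theorem of_cover {A : Set 𝒳}
    (h : ∀ K, ∃ (𝒴 : Arena.{u}) (c : Cover K 𝒴 𝒳), Unravelable 𝒴 (c.π ⁻¹' A)) :
    Unravelable 𝒳 A := by
  intro K
  obtain ⟨𝒴, c, hc⟩ := h K
  obtain ⟨𝒵, c', m, hm⟩ := hc K
  exact ⟨𝒵, c.comp c', m, hm⟩

end Unravelable

theorem exists_thread {X : ℕ → Type u} {p : ∀ i, X (i + 1) → X i} {P : ∀ i, Set (X i)}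
    (h : ∀ i, ∀ x ∈ P i, ∃ y ∈ P (i + 1), p i y = x) {x : X 0} (hx : x ∈ P 0) :
    ∃ t : ∀ i, X i, t 0 = x ∧ (∀ i, p i (t (i + 1)) = t i) ∧ ∀ i, t i ∈ P i := by
  choose g hg hg' using h
  let t : ∀ i, P i := fun i => Nat.rec ⟨x, hx⟩ (fun i y => ⟨g i y y.2, hg i y y.2⟩) i
  exact ⟨fun i => (t i).1, rfl, fun i => hg' i _ (t i).2, fun i => (t i).2⟩

theorem exists_thread_through {X : ℕ → Type u} {p : ∀ i, X (i + 1) → X i}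
    (h : ∀ i x, ∃ y, p i y = x) (j : ℕ) (x : X j) :
    ∃ t : ∀ i, X i, t j = x ∧ ∀ i, p i (t (i + 1)) = t i := by
  induction j generalizing X with
  | zero =>
    obtain ⟨t, h1, h2, -⟩ := exists_thread (X := X) (p := p) (P := fun _ => Set.univ) (x := x)
      (fun i x _ => (h i x).imp fun y hy => ⟨trivial, hy⟩) trivial
    exact ⟨t, h1, h2⟩
  | succ j ih =>
    obtain ⟨t, h1, h2⟩ := ih (X := fun i => X (i + 1)) (p := fun i => p (i + 1))
      (fun i => h (i + 1)) x
    refine ⟨fun i => Nat.casesOn i (p 0 (t 0)) t, h1, fun i => ?_⟩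
    cases i with
    | zero => rfl
    | succ i => exact h2 i

namespace Strat

variable {𝒳 : Arena.{u}} {b : Bool}

/-- The limit of a sequence of quasistrategies that stabilize level by level. -/
def limit (S : ℕ → Strat 𝒳 b) (h : ∀ n, Agree n (S (n + 1)) (S n)) : Strat 𝒳 b where
  R := fun n => (S n).R n
  start := (S 0).start
  mono := fun n x hx => by
    rw [← h n n le_rfl]
    exact (S (n + 1)).mono n x hx
  resp := fun n => (S n).resp n
  own := fun n hb x hx => by
    rw [← h n n le_rfl] at hx
    exact (S (n + 1)).own n hb x hx
  opp := fun n hb x hx => by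
    rw [← h n n le_rfl] at hx
    exact (S (n + 1)).opp n hb x hx

theorem agree_limit (S : ℕ → Strat 𝒳 b) (h : ∀ n, Agree n (S (n + 1)) (S n)) (n : ℕ) :
    Agree n (limit S h) (S n) := by
  intro m hm
  induction n, hm using Nat.le_induction with
  | base => rfl
  | succ n hn ih => rw [ih, h n m hn]

end Strat

namespace Limit

variable {K : ℕ} {𝒳 : ℕ → Arena.{u}} (c : ∀ i, Cover (K + i) (𝒳 (i + 1)) (𝒳 i))

/-- The inverse limit of a sequence of coverings. -/
def arena : Arena.{u} where
  X := {x : ∀ i, 𝒳 i // ∀ i, (c i).π (x (i + 1)) = x i}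
  E := fun n x y => ∀ i, (𝒳 i).E n (x.1 i) (y.1 i)
  equiv := fun _ => ⟨fun _ _ => Arena.refl _ _ _, fun h i => Arena.symm (h i),
    fun h h' i => Arena.trans (h i) (h' i)⟩
  mono := fun n _ _ h i => (𝒳 i).mono n _ _ (h i)
  zero := fun _ _ i => (𝒳 i).zero _ _
  sep := fun x y h => Subtype.ext (funext fun i => (𝒳 i).sep _ _ fun n => h n i)
  complete := by
    intro x hx
    choose y hy using fun i => (𝒳 i).complete (fun n => (x n).1 i) fun n => hx n i
    refine ⟨⟨y, fun i => (𝒳 i).sep _ _ fun n => ?_⟩, fun n i => hy i n⟩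
    have h := (c i).nonexp n _ _ (hy (i + 1) n)
    rw [(x n).2 i] at h
    exact Arena.trans h (Arena.symm (hy i n))

variable {c}

theorem level_of_level {n i : ℕ} (hn : n ≤ K + i) {x y : arena c}
    (h : (𝒳 i).E n (x.1 i) (y.1 i)) : (arena c).E n x y := by
  have hdown : ∀ j, (𝒳 j).E n (x.1 j) (y.1 j) → ∀ k ≤ j, (𝒳 k).E n (x.1 k) (y.1 k) := by
    intro j
    induction j with
    | zero =>
      intro h k hk
      obtain rfl : k = 0 := by omega
      exact h
    | succ j ih =>
      intro h k hk
      rcases Nat.lt_or_ge j k with hk' | hk'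
      · obtain rfl : k = j + 1 := by omega
        exact h
      · refine ih ?_ k hk'
        rw [← x.2 j, ← y.2 j]
        exact (c j).nonexp n _ _ h
  intro k
  rcases le_total k i with hk | hk
  · exact hdown i h k hk
  · induction k, hk using Nat.le_induction with
    | base => exact h
    | succ k hk ih =>
      refine (c k).inj n (by omega) _ _ ?_
      rw [x.2 k, y.2 k]
      exact ih

theorem surj (i : ℕ) (x : 𝒳 i) : ∃ y : arena c, y.1 i = x := by
  obtain ⟨t, h1, h2⟩ := exists_thread_through (X := fun i => 𝒳 i) (fun i => (c i).surj) i x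
  exact ⟨⟨t, h2⟩, h1⟩

variable {b : Bool}

/-- The quasistrategy for `𝒳 i` that follows a quasistrategy for the limit up to level `K + i`. -/
def trunc (θ : Strat (arena c) b) (i : ℕ) : Strat (𝒳 i) b where
  R := fun n x => ∃ y : arena c, θ.R (min n (K + i)) y ∧ (𝒳 i).E (min n (K + i)) (y.1 i) x
  start := fun x => by
    obtain ⟨y, rfl⟩ := surj (c := c) i x
    refine ⟨y, ?_, Arena.refl _ _ _⟩
    rw [Nat.zero_min]
    exact θ.start y
  mono := fun n x ⟨y, h1, h2⟩ =>
    ⟨y, θ.anti (min_le_min_right _ (Nat.le_succ n)) h1,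
      Arena.anti (min_le_min_right _ (Nat.le_succ n)) h2⟩
  resp := fun n x z h ⟨y, h1, h2⟩ => ⟨y, h1, Arena.trans h2 (Arena.anti (min_le_left _ _) h)⟩
  own := fun n hb x ⟨y, h1, h2⟩ => by
    rcases Nat.lt_or_ge n (K + i) with hn | hn
    · rw [min_eq_left hn.le] at h1 h2
      obtain ⟨z, h3, h4⟩ := θ.own n hb y h1
      refine ⟨z.1 i, Arena.trans (Arena.symm h2) (h3 i), z, ?_, Arena.refl _ _ _⟩
      rwa [min_eq_left (by omega)]
    · rw [min_eq_right hn] at h1 h2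
      refine ⟨x, Arena.refl _ _ _, y, ?_⟩
      rw [min_eq_right (by omega)]
      exact ⟨h1, h2⟩
  opp := fun n hb x ⟨y, h1, h2⟩ => by
    rcases Nat.lt_or_ge n (K + i) with hn | hn
    · rw [min_eq_left hn.le] at h1 h2
      obtain ⟨z, rfl⟩ := surj (c := c) i x
      refine ⟨z, ?_, Arena.refl _ _ _⟩
      rw [min_eq_left (by omega)]
      exact θ.opp n hb z (θ.resp n y z (level_of_level hn.le h2) h1)
    · rw [min_eq_right hn] at h1 h2
      refine ⟨y, ?_⟩
      rw [min_eq_right (by omega)]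
      exact ⟨h1, h2⟩

theorem trunc_of_le (θ : Strat (arena c) b) {i n : ℕ} (hn : n ≤ K + i) (x : 𝒳 i) :
    (trunc θ i).R n x ↔ ∃ y : arena c, θ.R n y ∧ (𝒳 i).E n (y.1 i) x := by
  change (∃ y : arena c, θ.R (min n (K + i)) y ∧ (𝒳 i).E (min n (K + i)) (y.1 i) x) ↔ _
  rw [min_eq_left hn]

/-- The `d`-th approximation to the transfer of a quasistrategy to `𝒳 i`. -/
def approx (θ : Strat (arena c) b) : ℕ → ∀ i, Strat (𝒳 i) b
  | 0, i => trunc θ i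
  | d + 1, i => (c i).φ b (approx θ d (i + 1))

theorem agree_approx (θ : Strat (arena c) b) (d i : ℕ) :
    Strat.Agree (K + i + d) (approx θ (d + 1) i) (approx θ d i) := by
  induction d generalizing i with
  | zero =>
    intro n hn
    funext x
    refine propext (((c i).low b _ n hn x).trans (Iff.trans ?_ (trunc_of_le θ hn x).symm))
    constructor
    · rintro ⟨y, h1, h2⟩
      obtain ⟨z, h3, h4⟩ := (trunc_of_le θ (by omega) y).1 h1
      refine ⟨z, h3, Arena.trans ?_ h2⟩
      rw [← z.2 i]
      exact (c i).nonexp n _ _ h4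
    · rintro ⟨z, h3, h4⟩
      refine ⟨z.1 (i + 1), (trunc_of_le θ (by omega) _).2 ⟨z, h3, Arena.refl _ _ _⟩, ?_⟩
      rw [z.2 i]
      exact h4
  | succ d ih =>
    refine (c i).loc b _ _ _ ((ih (i + 1)).anti ?_)
    omega

theorem approx_loc {n : ℕ} {θ θ' : Strat (arena c) b} (h : Strat.Agree n θ θ') (d i : ℕ) :
    Strat.Agree n (approx θ d i) (approx θ' d i) := by
  induction d generalizing i with
  | zero =>
    intro m hm
    funext x
    simp only [approx, trunc]
    rw [h _ ((min_le_left m (K + i)).trans hm)]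
  | succ d ih => exact (c i).loc b _ _ _ (ih (i + 1))

/-- The transfer of a quasistrategy for the limit to `𝒳 i`. -/
def transfer (θ : Strat (arena c) b) (i : ℕ) : Strat (𝒳 i) b :=
  Strat.limit (fun d => approx θ d i) fun d => (agree_approx θ d i).anti (by omega)

theorem agree_transfer (θ : Strat (arena c) b) (d i : ℕ) :
    Strat.Agree d (transfer θ i) (approx θ d i) :=
  Strat.agree_limit _ _ d

theorem transfer_succ (θ : Strat (arena c) b) (i : ℕ) :
    (c i).φ b (transfer θ (i + 1)) = transfer θ i := by
  refine Strat.ext (funext fun n => ?_)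
  rw [(c i).loc b n _ _ (agree_transfer θ n (i + 1)) n le_rfl,
    agree_transfer θ (n + 1) i n (Nat.le_succ n)]
  rfl

theorem transfer_of_le (θ : Strat (arena c) b) {i n : ℕ} (hn : n ≤ K + i) (x : 𝒳 i) :
    (transfer θ i).R n x ↔ ∃ y : arena c, θ.R n y ∧ (𝒳 i).E n (y.1 i) x := by
  have h : ∀ d, (approx θ d i).R n = (trunc θ i).R n := by
    intro d
    induction d with
    | zero => rfl
    | succ d ih => rw [agree_approx θ d i n (by omega), ih]
  rw [← trunc_of_le θ hn x, ← h n]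
  rfl

variable (c)

/-- The inverse limit covers the first arena of the sequence. -/
def cover : Cover K (arena c) (𝒳 0) where
  π := fun x => x.1 0
  nonexp := fun _ _ _ h => h 0
  inj := fun _ hn _ _ h => level_of_level hn h
  surj := surj 0
  φ := fun _ θ => transfer θ 0
  loc := fun _ n _ _ h => ((agree_transfer _ n 0).trans (approx_loc h n 0)).trans
    (agree_transfer _ n 0).symm
  low := fun _ θ _ hn x => transfer_of_le θ hn x
  lift := fun b θ x hx => by
    obtain ⟨t, h1, h2, h3⟩ := exists_thread (X := fun i => 𝒳 i) (p := fun i => (c i).π)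
      (P := fun i => {x | ∀ n, (transfer θ i).R n x}) (x := x)
      (fun i x hx => (c i).lift b _ x (by rw [transfer_succ]; exact hx)) hx
    refine ⟨⟨t, h2⟩, fun n => ?_, h1⟩
    obtain ⟨y, h4, h5⟩ := (transfer_of_le θ (Nat.le_add_left n K) (t n)).1 (h3 n n)
    exact θ.resp n y _ (level_of_level (Nat.le_add_left n K) h5) h4

end Limit

/-- The preimage of `A` under every nonexpansive map is unravelable. -/
def UnivUnravelable (𝒳 : Arena.{u}) (A : Set 𝒳) : Prop :=
  ∀ (𝒴 : Arena.{u}) (f : 𝒴 → 𝒳), (∀ n x y, 𝒴.E n x y → 𝒳.E n (f x) (f y)) →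
    Unravelable 𝒴 (f ⁻¹' A)

namespace UnivUnravelable

variable {𝒳 : Arena.{u}} {A : Set 𝒳}

theorem compl (h : UnivUnravelable 𝒳 A) : UnivUnravelable 𝒳 Aᶜ := fun 𝒴 f hf =>
  (h 𝒴 f hf).compl

theorem of_open (hA : ∀ y ∈ A, ∃ j, ∀ z, 𝒳.E j y z → z ∈ A) : UnivUnravelable 𝒳 A := by
  refine fun 𝒴 f hf => Unravelable.of_open fun y hy => ?_
  obtain ⟨j, hj⟩ := hA _ hy
  exact ⟨j, fun z hz => hj _ (hf _ _ _ hz)⟩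

theorem unravelable_iUnion {A : ℕ → Set 𝒳} (h : ∀ i, UnivUnravelable 𝒳 (A i)) :
    Unravelable 𝒳 (⋃ i, A i) := by
  refine Unravelable.of_cover fun K => ?_
  let S := (𝒴 : Arena.{u}) ×' {f : 𝒴 → 𝒳 // ∀ n x y, 𝒴.E n x y → 𝒳.E n (f x) (f y)}
  choose Z d m hm using fun (i : ℕ) (s : S) => h i s.1 s.2.1 s.2.2 (K + i)
  let s : ℕ → S := fun i => Nat.rec ⟨𝒳, fun x => x, fun _ _ _ h => h⟩
    (fun i s => ⟨Z i s, fun x => s.2.1 ((d i s).π x),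
      fun n x y h => s.2.2 _ _ _ ((d i s).nonexp n x y h)⟩) i
  let c : ∀ i, Cover (K + i) (s (i + 1)).1 (s i).1 := fun i => d i (s i)
  refine ⟨Limit.arena (𝒳 := fun i => (s i).1) c, Limit.cover (𝒳 := fun i => (s i).1) c,
    Unravelable.of_open fun x hx => ?_⟩
  have hs : ∀ (y : Limit.arena (𝒳 := fun i => (s i).1) c) i, (s i).2.1 (y.1 i) = y.1 0 := by
    intro y i
    induction i with
    | zero => rfl
    | succ i ih =>
      rw [← ih, ← y.2 i]
  obtain ⟨i, hi⟩ := Set.mem_iUnion.1 hx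
  refine ⟨m i (s i), fun y hy => Set.mem_iUnion.2 ⟨i, ?_⟩⟩
  have h1 := hm i (s i) _ _ (hy (i + 1))
  have h2 : ∀ z : Limit.arena (𝒳 := fun i => (s i).1) c,
      (s i).2.1 ((d i (s i)).π (z.1 (i + 1))) = z.1 0 := fun z => hs z (i + 1)
  simp only [Set.mem_preimage, h2] at h1
  exact h1 hi

theorem iUnion {A : ℕ → Set 𝒳} (h : ∀ i, UnivUnravelable 𝒳 (A i)) :
    UnivUnravelable 𝒳 (⋃ i, A i) := by
  intro 𝒴 f hf
  rw [Set.preimage_iUnion]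
  exact unravelable_iUnion fun i 𝒵 g hg => h i 𝒵 (f ∘ g) fun n x y hxy => hf n _ _ (hg n x y hxy)

end UnivUnravelable

theorem Strat.exists_of_win {𝒳 : Arena.{u}} {b : Bool} {T : Set 𝒳}
    (h : ∀ x, 𝒳.board.Win b T 0 x) : ∃ θ : Strat 𝒳 b, ∀ x, (∀ n, θ.R n x) → x ∈ T := by
  obtain ⟨R, ⟨hresp, hown, hopp⟩, h0, hlim⟩ := Board.glue (B := 𝒳.board) (b := b) (T := T) 0
    (fun _ _ => False) (fun _ _ _ _ _ h => h) (fun _ _ _ _ h => h.elim)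
    (fun _ _ _ _ h => h.elim) (fun _ h => (h 0 le_rfl).elim)
  have hR : ∀ n x y, 𝒳.E n x y → (∀ m ≤ n, R m x) → ∀ m ≤ n, R m y := fun n x y hxy hx m hm =>
    hresp m (Nat.zero_le m) x y (Arena.anti hm hxy) (hx m hm)
  refine ⟨⟨fun n x => ∀ m ≤ n, R m x, fun x m hm => ?_, fun n x hx m hm => hx m (by omega), hR,
    fun n hb x hx => ?_, fun n hb x hx m hm => ?_⟩, fun x hx =>
    hlim x fun n _ => hx n n le_rfl⟩
  · obtain rfl : m = 0 := by omega
    exact (h0 x).2 (Or.inr (h x))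
  · obtain ⟨y, hy, hy'⟩ := hown n (Nat.zero_le n) hb x (hx n le_rfl)
    refine ⟨y, hy, fun m hm => ?_⟩
    rcases Nat.lt_or_ge n m with h1 | h1
    · obtain rfl : m = n + 1 := by omega
      exact hy'
    · exact hR n x y hy hx m h1
  · rcases Nat.lt_or_ge n m with h1 | h1
    · obtain rfl : m = n + 1 := by omega
      exact hopp n (Nat.zero_le n) hb x (hx n le_rfl)
    · exact hx m h1

/-- Determinacy of games whose winning set is decided at a finite level. -/
theorem Strat.determined_of_level {𝒳 : Arena.{u}} {A : Set 𝒳} {m : ℕ}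
    (hA : ∀ x y, 𝒳.E m x y → x ∈ A → y ∈ A) :
    (∃ θ : Strat 𝒳 false, ∀ x, (∀ n, θ.R n x) → x ∈ A) ∨
      ∃ θ : Strat 𝒳 true, ∀ x, (∀ n, θ.R n x) → x ∉ A := by
  by_cases h : ∀ x, 𝒳.board.Win false A 0 x
  · exact Or.inl (Strat.exists_of_win h)
  · push Not at h
    obtain ⟨x, hx⟩ := h
    refine Or.inr (Strat.exists_of_win (T := Aᶜ) fun y => ?_)
    have hc : 𝒳.ClosedSet Set.univ := fun _ _ => trivial
    have hb : 𝒳.ClosedFrom false 0 Set.univ Set.univ := fun _ _ _ _ _ y _ _ =>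
      ⟨y, trivial, 𝒳.refl _ _⟩
    obtain ⟨z, -, hxz, hz⟩ := Arena.exists_avoid hc hb ⟨x, trivial, 𝒳.refl _ _⟩ hx
    refine Board.Win.resp (B := 𝒳.board) (𝒳.zero z y) (Arena.win_of_subset (hc.avoid x)
      (Arena.closedFrom_avoid hc hb x) ⟨trivial, hxz, hz⟩ fun w hw _ hwA => ?_)
    exact hw.2.2 m (Nat.zero_le m) (Arena.win_of_subset (Unfold.closedSet_class m w)
      (Unfold.closedFrom_class _ _ _) (𝒳.refl _ _) fun v _ hv => hA _ _ hv hwA)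

theorem Unravelable.determined {𝒳 : Arena.{u}} {A : Set 𝒳} (h : Unravelable 𝒳 A) :
    (∃ θ : Strat 𝒳 false, ∀ x, (∀ n, θ.R n x) → x ∈ A) ∨
      ∃ θ : Strat 𝒳 true, ∀ x, (∀ n, θ.R n x) → x ∉ A := by
  obtain ⟨𝒴, c, m, hm⟩ := h 0
  rcases Strat.determined_of_level (A := c.π ⁻¹' A) hm with ⟨θ, hθ⟩ | ⟨θ, hθ⟩
  · refine Or.inl ⟨c.φ _ θ, fun x hx => ?_⟩
    obtain ⟨y, hy, rfl⟩ := c.lift _ θ x hx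
    exact hθ y hy
  · refine Or.inr ⟨c.φ _ θ, fun x hx => ?_⟩
    obtain ⟨y, hy, rfl⟩ := c.lift _ θ x hx
    exact hθ y hy

namespace SeqGame

section Determinacy

variable {C : Type u}

theorem length_pre (p : ℕ → C) (n : ℕ) : (pre p n).length = n := by
  simp [pre]

theorem pre_succ (p : ℕ → C) (n : ℕ) : pre p (n + 1) = pre p n ++ [p n] := by
  simp only [pre, List.ofFn_succ_last, Fin.val_castSucc, Fin.val_last]

theorem pre_eq_pre_iff {p q : ℕ → C} {n : ℕ} : pre p n = pre q n ↔ ∀ i < n, p i = q i := by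
  rw [pre, pre, List.ofFn_inj, funext_iff, Fin.forall_iff]

theorem pre_eq_of_le {p q : ℕ → C} {m n : ℕ} (hmn : m ≤ n) (h : pre p n = pre q n) :
    pre p m = pre q m :=
  pre_eq_pre_iff.2 fun i hi => pre_eq_pre_iff.1 h i (hi.trans_le hmn)

/-- The arena of infinite sequences over `C` in which the player of parity `false` moves at the
histories satisfying `t`, and the other player moves at the other ones. -/
def arena (t : List C → Prop) : Arena.{u} where
  X := ℕ → C
  E := fun n p q => ∀ i, (2 * i + 1 < n ∨ 2 * i + 1 = n ∧ t (pre p i)) → p i = q i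
  equiv := fun n => by
    have hpre : ∀ p q : ℕ → C, (∀ i, (2 * i + 1 < n ∨ 2 * i + 1 = n ∧ t (pre p i)) → p i = q i) →
        ∀ i, 2 * i + 1 ≤ n → pre p i = pre q i := fun p q h i hi =>
      pre_eq_pre_iff.2 fun j hj => h j (Or.inl (by omega))
    refine ⟨fun p i _ => rfl, fun {p q} h i hi => ?_, fun {p q r} h h' i hi => ?_⟩
    · refine (h i (hi.imp_right fun h1 => ⟨h1.1, ?_⟩)).symm
      rw [hpre p q h i h1.1.le]
      exact h1.2
    · refine (h i hi).trans (h' i (hi.imp_right fun h1 => ⟨h1.1, ?_⟩))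
      rw [← hpre p q h i h1.1.le]
      exact h1.2
  mono := fun n p q h i hi => h i (Or.inl (by omega))
  zero := fun p q i hi => by omega
  sep := fun p q h => funext fun i => h (2 * i + 2) i (Or.inl (by omega))
  complete := by
    intro x hx
    have h1 : ∀ i n, 2 * i + 2 ≤ n → x (2 * i + 2) i = x n i := by
      intro i n hn
      induction n, hn using Nat.le_induction with
      | base => rfl
      | succ n hn ih => exact ih.trans (hx n i (Or.inl (by omega)))
    refine ⟨fun i => x (2 * i + 2) i, fun n i hi => ?_⟩
    rcases hi with hi | ⟨rfl, hi⟩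
    · exact h1 i n hi
    · refine (hx (2 * i + 1) i (Or.inr ⟨rfl, ?_⟩)).symm
      convert hi using 1
      exact pre_eq_pre_iff.2 fun j hj => (h1 j _ (by omega)).symm

theorem arena_E_even {t : List C → Prop} {p q : ℕ → C} {k : ℕ} :
    (arena t).E (2 * k) p q ↔ pre p k = pre q k := by
  rw [pre_eq_pre_iff]
  exact ⟨fun h i hi => h i (Or.inl (by omega)), fun h i hi => h i (by omega)⟩

theorem arena_E_odd {t : List C → Prop} {p q : ℕ → C} {k : ℕ} :
    (arena t).E (2 * k + 1) p q ↔ pre p k = pre q k ∧ (t (pre p k) → p k = q k) := by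
  rw [pre_eq_pre_iff]
  refine ⟨fun h => ⟨fun i hi => h i (Or.inl (by omega)), fun ht => h k (Or.inr ⟨rfl, ht⟩)⟩,
    fun h i hi => ?_⟩
  rcases hi with hi | ⟨hi, ht⟩
  · exact h.1 i (by omega)
  · obtain rfl : i = k := by omega
    exact h.2 ht

theorem exists_strategy_of_strat [Nonempty C] {t : List C → Prop} {b : Bool}
    (θ : Strat (arena t) b) : ∃ σ : List C → C, ∀ p : ℕ → C,
      (∀ n, (t (pre p n) ↔ b = false) → p n = σ (pre p n)) → ∀ n, θ.R n p := by
  classical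
  let P : List C → (ℕ → C) → Prop := fun l q =>
    pre q l.length = l ∧ θ.R (2 * (l.length + 1)) q
  refine ⟨fun l => Classical.epsilon (P l) l.length, fun p hp => ?_⟩
  have key : ∀ k, θ.R (2 * k) p := by
    intro k
    induction k with
    | zero => exact θ.start p
    | succ k ih =>
      obtain ⟨q, hq, hq'⟩ : ∃ q, P (pre p k) q ∧
          ((t (pre p k) ↔ b = false) → p k = q k) := by
        refine ⟨Classical.epsilon (P (pre p k)), Classical.epsilon_spec ?_, fun h => ?_⟩
        · obtain ⟨q, h1, h2⟩ := θ.extend (show 2 * k ≤ 2 * (k + 1) by omega) ih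
          refine ⟨q, ?_, ?_⟩
          · rw [length_pre]; exact (arena_E_even.1 h1).symm
          · rw [length_pre]; exact h2
        · simpa only [length_pre] using hp k h
      simp only [P, length_pre] at hq
      obtain ⟨h1, h2⟩ := hq
      by_cases hk : t (pre p k) ↔ b = false
      · refine θ.resp _ q p (arena_E_even.2 ?_) h2
        rw [pre_succ, pre_succ, h1, hq' hk]
      · cases b with
        | false =>
          have ht : ¬ t (pre p k) := fun h => hk ⟨fun _ => rfl, fun _ => h⟩
          refine θ.opp (2 * k + 1) (by simp) p (θ.resp _ q p (arena_E_odd.2 ⟨h1, fun h => ?_⟩)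
            (θ.anti (by omega) h2))
          exact absurd (h1 ▸ h) ht
        | true =>
          have ht : t (pre p k) := by
            by_contra ht
            exact hk ⟨fun h => absurd h ht, fun h => by simp at h⟩
          obtain ⟨(y : ℕ → C), h3, h4⟩ := θ.own (2 * k + 1) (by simp) p (θ.opp (2 * k) (by simp) p ih)
          obtain ⟨h5, h6⟩ := arena_E_odd.1 h3
          refine θ.resp _ y p (arena_E_even.2 ?_) h4
          rw [pre_succ, pre_succ, h5, h6 ht]
  exact fun n => θ.anti (by omega) (key n)

theorem univUnravelable_of_borel [TopologicalSpace C] [DiscreteTopology C] (t : List C → Prop)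
    {W : Set (ℕ → C)} (hW : @MeasurableSet _ (borel (ℕ → C)) W) :
    UnivUnravelable (arena t) W := by
  let M : MeasurableSpace (ℕ → C) :=
    { MeasurableSet' := UnivUnravelable (arena t)
      measurableSet_empty := UnivUnravelable.of_open fun _ h => h.elim
      measurableSet_compl := fun _ h => h.compl
      measurableSet_iUnion := fun _ h => UnivUnravelable.iUnion h }
  refine (MeasurableSpace.generateFrom_le fun s hs => ?_ : borel (ℕ → C) ≤ M) W hW
  refine UnivUnravelable.of_open fun p hp => ?_
  obtain ⟨_, ⟨x, n, rfl⟩, h1, h2⟩ := (PiNat.isTopologicalBasis_cylinders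
    (E := fun _ => C)).exists_subset_of_mem_open hp hs
  refine ⟨2 * n, fun q hq => h2 fun i hi => ?_⟩
  rw [← h1 i hi]
  exact (hq i (Or.inl (by omega))).symm

/-- Borel determinacy, for games in which the turns are given by a predicate on histories. -/
theorem borel_determined [Nonempty C] [TopologicalSpace C] [DiscreteTopology C]
    (t : List C → Prop) {W : Set (ℕ → C)} (hW : @MeasurableSet _ (borel (ℕ → C)) W) :
    (∃ σ : List C → C, ∀ p, (∀ n, t (pre p n) → p n = σ (pre p n)) → p ∈ W) ∨
      ∃ σ : List C → C, ∀ p, (∀ n, ¬ t (pre p n) → p n = σ (pre p n)) → p ∉ W := by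
  have h := (univUnravelable_of_borel t hW) (arena t) (fun p => p) (fun _ _ _ h => h)
  rcases h.determined with ⟨θ, hθ⟩ | ⟨θ, hθ⟩
  · obtain ⟨σ, hσ⟩ := exists_strategy_of_strat θ
    exact Or.inl ⟨σ, fun p hp => hθ p (hσ p fun n hn => hp n (hn.2 rfl))⟩
  · obtain ⟨σ, hσ⟩ := exists_strategy_of_strat θ
    refine Or.inr ⟨σ, fun p hp => hθ p (hσ p fun n hn => hp n fun h => ?_)⟩
    simpa using hn.1 h

end Determinacy

end SeqGame

namespace SeqGame

section Forcing

variable {A C : Type*}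

theorem hist_eq_pre (σ : List C → C) (γ : List C) (n : ℕ) : hist σ γ n = pre (play σ γ) n := by
  induction n with
  | zero => rfl
  | succ n ih => rw [pre_succ, ← ih]; rfl

theorem play_of_le (σ : List C → C) {γ : List C} {n : ℕ} (hn : γ.length ≤ n) :
    play σ γ n = σ (pre (play σ γ) n) := by
  rw [← hist_eq_pre, play, dif_neg (by omega)]

theorem pre_play_length (σ : List C → C) (γ : List C) : pre (play σ γ) γ.length = γ := by
  refine List.ext_getElem (length_pre _ _) fun n h1 h2 => ?_
  simp [pre, play]

theorem play_nil_eq {σ : List C → C} {p : ℕ → C} (h : ∀ n, p n = σ (pre p n)) :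
    play σ [] = p := by
  have key : ∀ n, pre (play σ []) n = pre p n := by
    intro n
    induction n with
    | zero => rfl
    | succ n ih => rw [pre_succ, pre_succ, ih, play_of_le σ (Nat.zero_le n), ih, ← h n]
  exact funext fun n => pre_eq_pre_iff.1 (key (n + 1)) n (Nat.lt_succ_self n)

/-- Player `a` forces `W` from the history `h` by following `σ`. -/
def Forcing (d : List C → A) (a : A) (σ : List C → C) (h : List C) (W : Set (ℕ → C)) : Prop :=
  ∀ p, pre p h.length = h → (∀ n, h.length ≤ n → d (pre p n) = a → p n = σ (pre p n)) → p ∈ W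

/-- The opponents of player `a` prevent `W` from the history `h` by following `σ`. -/
def Blocking (d : List C → A) (a : A) (σ : List C → C) (h : List C) (W : Set (ℕ → C)) : Prop :=
  ∀ p, pre p h.length = h → (∀ n, h.length ≤ n → d (pre p n) ≠ a → p n = σ (pre p n)) → p ∉ W

variable {d : List C → A} {a : A} {σ : List C → C} {h : List C} {W : Set (ℕ → C)}

theorem Forcing.append {c : C} (hσ : Forcing d a σ h W) (hc : d h = a → c = σ h) :
    Forcing d a σ (h ++ [c]) W := by
  intro p hp hp'
  rw [List.length_append, List.length_singleton, pre_succ] at hp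
  obtain ⟨h1, h2⟩ := List.append_inj' hp rfl
  refine hσ p h1 fun n hn hd => ?_
  rcases hn.eq_or_lt with rfl | hn
  · rw [h1] at hd ⊢
    rw [← hc hd]
    exact List.singleton_injective h2
  · exact hp' n (by simpa using hn) hd

theorem Forcing.of_append {c : C} (hσ : Forcing d a σ (h ++ [c]) W) (hd : d h = a) :
    ∃ τ, Forcing d a τ h W := by
  classical
  refine ⟨fun l => if l = h then c else σ l, fun p hp hp' => hσ p ?_ fun n hn hd' => ?_⟩
  · have h1 := hp' h.length le_rfl (by rw [hp]; exact hd)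
    rw [hp] at h1
    rw [List.length_append, List.length_singleton, pre_succ, hp, h1]
    simp
  · rw [List.length_append, List.length_singleton] at hn
    refine (hp' n (by omega) hd').trans (if_neg ?_)
    intro h1
    have := congrArg List.length h1
    rw [length_pre] at this
    omega

theorem Forcing.exists_mem (hσ : Forcing d a σ h W) : ∃ p, p ∈ W :=
  ⟨play σ h, hσ _ (pre_play_length σ h) fun _ hn _ => play_of_le σ hn⟩

theorem forcing_or_blocking [Nonempty C] [TopologicalSpace C] [DiscreteTopology C]
    (d : List C → A) (a : A) (h : List C) (hW : @MeasurableSet _ (borel (ℕ → C)) W) :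
    (∃ σ, Forcing d a σ h W) ∨ ∃ σ, Blocking d a σ h W := by
  let g : (ℕ → C) → ℕ → C := fun q n => if hn : n < h.length then h[n] else q (n - h.length)
  have hg : Continuous g := by
    refine continuous_pi fun n => ?_
    by_cases hn : n < h.length
    · simp only [g, dif_pos hn]
      exact continuous_const
    · simp only [g, dif_neg hn]
      exact continuous_apply _
  have hgW : @MeasurableSet _ (borel (ℕ → C)) (g ⁻¹' W) := by
    let _ := borel (ℕ → C)
    have : BorelSpace (ℕ → C) := ⟨rfl⟩
    exact hg.measurable hW
  have hpre : ∀ p : ℕ → C, pre p h.length = h →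
      ∀ n, h ++ pre (fun k => p (h.length + k)) n = pre p (h.length + n) := by
    intro p hp n
    induction n with
    | zero => simpa [pre] using hp.symm
    | succ n ih => rw [pre_succ, ← List.append_assoc, ih, ← Nat.add_assoc, pre_succ]
  have hgp : ∀ p : ℕ → C, pre p h.length = h → g (fun k => p (h.length + k)) = p := by
    intro p hp
    funext n
    by_cases hn : n < h.length
    · simp only [g, dif_pos hn]
      conv_lhs => enter [1]; rw [← hp]
      simp [pre]
    · simp only [g, dif_neg hn]
      congr 1
      omega
  have hfollow : ∀ (σ : List C → C) (p : ℕ → C) (P : List C → Prop), pre p h.length = h →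
      (∀ n, h.length ≤ n → P (pre p n) → p n = σ ((pre p n).drop h.length)) → ∀ n,
      P (h ++ pre (fun k => p (h.length + k)) n) →
        p (h.length + n) = σ (pre (fun k => p (h.length + k)) n) := by
    intro σ p P hp hp' n hn
    rw [hpre p hp n] at hn
    rw [hp' _ (Nat.le_add_right _ _) hn, ← hpre p hp n, List.drop_left]
  rcases borel_determined (fun l => d (h ++ l) = a) hgW with ⟨σ, hσ⟩ | ⟨σ, hσ⟩
  · refine Or.inl ⟨fun l => σ (l.drop h.length), fun p hp hp' => ?_⟩
    have := hσ _ (hfollow σ p (fun l => d l = a) hp hp')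
    rwa [Set.mem_preimage, hgp p hp] at this
  · refine Or.inr ⟨fun l => σ (l.drop h.length), fun p hp hp' => ?_⟩
    have := hσ _ (hfollow σ p (fun l => d l ≠ a) hp hp')
    rwa [Set.mem_preimage, hgp p hp] at this

/-- A play along which every player gets what he can force from each of its histories. -/
theorem exists_play_of_forcing {d : List C → A} {W : A → ℕ → Set (ℕ → C)}
    (hW : ∀ a, Antitone (W a)) {ρ : A → List C → ℕ} {s : A → List C → List C → C}
    (hs : ∀ a h, Forcing d a (s a h) h (W a (ρ a h)))
    (hmax : ∀ a h i σ, Forcing d a σ h (W a i) → i ≤ ρ a h) (hbdd : ∀ a, ∃ M, ∀ h, ρ a h ≤ M) :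
    ∃ p, ∀ a n, p ∈ W a (ρ a (pre p n)) := by
  classical
  let x : ℕ → List C × (A → List C → C) := fun n => Nat.rec ([], fun a => s a [])
    (fun _ y => (y.1 ++ [y.2 (d y.1) y.1], fun a =>
      if ρ a (y.1 ++ [y.2 (d y.1) y.1]) = ρ a y.1 then y.2 a
      else s a (y.1 ++ [y.2 (d y.1) y.1]))) n
  let p : ℕ → C := fun n => (x n).2 (d (x n).1) (x n).1
  have hx : ∀ n, (x n).1 = pre p n := by
    intro n
    induction n with
    | zero => rfl
    | succ n ih => rw [pre_succ, ← ih]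
  have hp : ∀ n, p n = (x n).2 (d (pre p n)) (pre p n) := fun n => by rw [← hx n]
  have hx' : ∀ n a, (x (n + 1)).2 a =
      if ρ a (pre p (n + 1)) = ρ a (pre p n) then (x n).2 a else s a (pre p (n + 1)) := by
    intro n a
    rw [← hx n, ← hx (n + 1)]
  have hforce : ∀ a n, Forcing d a ((x n).2 a) (pre p n) (W a (ρ a (pre p n))) ∧
      ρ a (pre p n) ≤ ρ a (pre p (n + 1)) := by
    intro a n
    have hstep : ∀ n, Forcing d a ((x n).2 a) (pre p n) (W a (ρ a (pre p n))) →
        Forcing d a ((x n).2 a) (pre p (n + 1)) (W a (ρ a (pre p n))) := by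
      intro n hn
      rw [pre_succ]
      refine hn.append fun hd => ?_
      rw [hp n, hd]
    have hforce : Forcing d a ((x n).2 a) (pre p n) (W a (ρ a (pre p n))) := by
      induction n with
      | zero => exact hs a []
      | succ n ih =>
        rw [hx' n a]
        split_ifs with h
        · rw [h]
          exact hstep n ih
        · exact hs a _
    exact ⟨hforce, hmax _ _ _ _ (hstep n hforce)⟩
  refine ⟨p, fun a n => ?_⟩
  have hmono : Monotone fun n => ρ a (pre p n) := monotone_nat_of_le_succ fun n => (hforce a n).2
  obtain ⟨M, hM⟩ := hbdd a
  have hB : BddAbove (Set.range fun n => ρ a (pre p n)) := by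
    refine ⟨M, ?_⟩
    rintro _ ⟨n, rfl⟩
    exact hM _
  obtain ⟨N, hN⟩ := Nat.sSup_mem (Set.range_nonempty fun n => ρ a (pre p n)) hB
  have hle : ∀ m, ρ a (pre p m) ≤ ρ a (pre p N) := fun m =>
    (le_csSup hB ⟨m, rfl⟩).trans_eq hN.symm
  have hconst : ∀ m, N ≤ m → (x m).2 a = (x N).2 a := by
    intro m hm
    induction m, hm using Nat.le_induction with
    | base => rfl
    | succ m hm ih =>
      rw [hx' m a, if_pos, ih]
      exact le_antisymm ((hle _).trans (hmono hm)) (hmono (Nat.le_succ m))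
  refine hW a (hle n) ((hforce a N).1 p (by rw [length_pre]) fun m hm hd => ?_)
  rw [length_pre] at hm
  rw [← hconst m hm]
  nth_rewrite 1 [hp m]
  rw [hd]

/-- A strategy profile that follows `p`, and punishes the first player who leaves `p` by means of
`β`. -/
theorem exists_punishing (d : List C → A) (p : ℕ → C) (β : A → List C → List C → C) :
    ∃ σ : List C → C, play σ [] = p ∧ ∀ a σ', Dev d a σ σ' → play σ' [] ≠ p →
      ∃ n, pre (play σ' []) n = pre p n ∧ d (pre p n) = a ∧
        ∀ k, n + 1 ≤ k → d (pre (play σ' []) k) ≠ a →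
          play σ' [] k = β a (pre (play σ' []) (n + 1)) (pre (play σ' []) k) := by
  classical
  let P : List C → (ℕ → C) × ℕ → Prop := fun l q =>
    pre q.1 l.length = l ∧ q.2 < l.length ∧ pre q.1 q.2 = pre p q.2 ∧ q.1 q.2 ≠ p q.2
  let σ : List C → C := fun l => if h : ∃ q, P l q then
    β (d (pre p h.choose.2)) (pre h.choose.1 (h.choose.2 + 1)) l else p l.length
  have hσp : ∀ n, σ (pre p n) = p n := by
    intro n
    have hn : ¬ ∃ q, P (pre p n) q := by
      rintro ⟨q, h1, h2, -, h4⟩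
      rw [length_pre] at h1 h2
      exact h4 (pre_eq_pre_iff.1 h1 _ h2)
    simp only [σ, dif_neg hn, length_pre]
  have hσq : ∀ q n k, pre q n = pre p n → q n ≠ p n → n + 1 ≤ k →
      σ (pre q k) = β (d (pre p n)) (pre q (n + 1)) (pre q k) := by
    intro q n k h1 h2 hk
    have hex : ∃ q', P (pre q k) q' := ⟨(q, n), by rw [length_pre], by rwa [length_pre], h1, h2⟩
    obtain ⟨h3, h4, h5, h6⟩ := hex.choose_spec
    rw [length_pre] at h3 h4
    have hn : hex.choose.2 = n := by
      rcases lt_trichotomy hex.choose.2 n with h | h | h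
      · refine absurd ?_ h6
        rw [pre_eq_pre_iff.1 h3 _ h4]
        exact pre_eq_pre_iff.1 h1 _ h
      · exact h
      · refine absurd ?_ h2
        rw [← pre_eq_pre_iff.1 h3 _ hk]
        exact pre_eq_pre_iff.1 h5 _ h
    simp only [σ, dif_pos hex]
    rw [hn, pre_eq_of_le hk h3]
  refine ⟨σ, play_nil_eq fun n => (hσp n).symm, fun a σ' hσ' hne => ?_⟩
  obtain ⟨n, hn⟩ := Function.ne_iff.1 hne
  have hex : ∃ n, play σ' [] n ≠ p n := ⟨n, hn⟩
  have hpre : pre (play σ' []) (Nat.find hex) = pre p (Nat.find hex) :=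
    pre_eq_pre_iff.2 fun i hi => not_not.1 (Nat.find_min hex hi)
  have hd : d (pre p (Nat.find hex)) = a := by
    by_contra hd
    refine Nat.find_spec hex ?_
    rw [play_of_le σ' (Nat.zero_le _), hpre, hσ' _ hd, hσp]
  refine ⟨Nat.find hex, hpre, hd, fun k hk hk' => ?_⟩
  rw [← hd, ← hσq _ _ k hpre (Nat.find_spec hex) hk, ← hσ' _ hk']
  exact play_of_le σ' (Nat.zero_le k)

end Forcing

end SeqGame

open SeqGame in
/-- an infinite sequential game with countably many players and Borel
measurable payoff functions into `[0,1]` has an `ε`-Nash equilibrium for every `ε > 0`. -/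
theorem stmt5 {A C : Type*} [Nonempty A] [Countable A] [Nonempty C]
    [TopologicalSpace C] [DiscreteTopology C]
    (d : List C → A) (f : A → (ℕ → C) → ℝ)
    (hf01 : ∀ (a : A) (p : ℕ → C), f a p ∈ Set.Icc (0 : ℝ) 1)
    (hmeas : ∀ a : A, @Measurable (ℕ → C) ℝ (borel (ℕ → C)) inferInstance (f a))
    (ε : ℝ) (hε : 0 < ε) :
    ∃ σ : List C → C, ∀ (a : A) (σ' : List C → C), Dev d a σ σ' →
      f a (play σ' []) ≤ f a (play σ []) + ε := by
  set W : A → ℕ → Set (ℕ → C) := fun a i => {p | i * ε ≤ f a p} with hWdef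
  have hW : ∀ a, Antitone (W a) := fun a i j hij p (hp : j * ε ≤ f a p) =>
    (mul_le_mul_of_nonneg_right (Nat.cast_le.2 hij) hε.le).trans hp
  have hWm : ∀ a i, @MeasurableSet _ (borel (ℕ → C)) (W a i) := fun a i =>
    hmeas a measurableSet_Ici
  have hbdd : ∀ a h i σ, Forcing d a σ h (W a i) → i ≤ ⌊1 / ε⌋₊ := by
    intro a h i σ hσ
    obtain ⟨p, hp⟩ := hσ.exists_mem
    exact Nat.le_floor ((le_div_iff₀ hε).2 (le_trans hp (hf01 a p).2))
  have hmax : ∀ a h, ∃ i, (∃ σ, Forcing d a σ h (W a i)) ∧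
      ∀ j σ, Forcing d a σ h (W a j) → j ≤ i := by
    intro a h
    have hB : BddAbove {i | ∃ σ, Forcing d a σ h (W a i)} :=
      ⟨_, fun i ⟨σ, hσ⟩ => hbdd a h i σ hσ⟩
    have hne : {i | ∃ σ, Forcing d a σ h (W a i)}.Nonempty :=
      ⟨0, fun _ => Classical.arbitrary C, fun p _ _ => by simpa [hWdef] using (hf01 a p).1⟩
    exact ⟨_, Nat.sSup_mem hne hB, fun j σ hσ => le_csSup hB ⟨σ, hσ⟩⟩
  choose ρ hρ hρmax using hmax
  choose s hs using hρ
  have hblock : ∀ a h, ∃ τ, Blocking d a τ h (W a (ρ a h + 1)) := by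
    intro a h
    refine (forcing_or_blocking d a h (hWm a (ρ a h + 1))).resolve_left ?_
    rintro ⟨σ, hσ⟩
    exact Nat.not_succ_le_self _ (hρmax a h _ σ hσ)
  choose β hβ using hblock
  obtain ⟨p, hp⟩ := exists_play_of_forcing hW hs hρmax
    fun a => ⟨_, fun h => hbdd a h _ _ (hs a h)⟩
  obtain ⟨σ, rfl, hσ⟩ := exists_punishing d p β
  refine ⟨σ, fun a σ' hσ' => ?_⟩
  by_cases hne : play σ' [] = play σ []
  · rw [hne]
    linarith
  obtain ⟨n, hn, hd, hk⟩ := hσ a σ' hσ' hne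
  set g := pre (play σ' []) (n + 1) with hg
  have hlen : g.length = n + 1 := length_pre _ _
  have hle : ρ a g ≤ ρ a (pre (play σ []) n) := by
    have hf := hs a g
    nth_rewrite 2 [hg] at hf
    rw [pre_succ, hn] at hf
    obtain ⟨τ, hτ⟩ := hf.of_append hd
    exact hρmax a _ _ τ hτ
  have h1 : ¬ ((ρ a g + 1 : ℕ) * ε ≤ f a (play σ' [])) := by
    refine hβ a g (play σ' []) (by rw [hlen]) fun k hgk hka => ?_
    rw [hlen] at hgk
    exact hk k hgk hka
  have h2 : (ρ a (pre (play σ []) n) : ℝ) * ε ≤ f a (play σ []) := hp a n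
  have h3 : (ρ a g : ℝ) * ε ≤ ρ a (pre (play σ []) n) * ε :=
    mul_le_mul_of_nonneg_right (Nat.cast_le.2 hle) hε.le
  push_cast at h1
  linarith
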